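/- arXiv:1507.07256 — 2 statements merged into one kernel-verified Lean document; each statement's English description precedes it below -/
import Mathlib

section
/- (Small far-region false detections, Corollary 2.5.) Let g be an admissible kernel with local-property constants ε, β. There exists a kernel-dependent separation constant ν > max(ε, β) such that for every N ≥ 1, σ > 0, δ ≥ 0, every summable x : ℤ → ℝ with support K satisfying min_{k_i,k_j ∈ K, i≠j} |k_i − k_j| ≥ Nνσ, every noise η with Σ_k |η[k]| ≤ δ and data y = g_σ ∗ x + η, and every minimizer x̂ of the convex program with support K̂: writing ℤ_far := {k ∈ ℤ : |k − k_m| > Nεσ for all k_m ∈ K} and K̂_far := ℤ_far ∩ K̂, one has Σ_{n : k̂_n ∈ K̂_far} |x̂[k̂_n]| ≤ (16 γ² / β) δ, where γ := max{Nσ, ε^{-1}}. -/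
/-- Definition 2 of the paper: an admissible kernel with local-property
constants `ε, β`. -/
structure IsAdmissibleKernel (g : ℝ → ℝ) (ε β : ℝ) : Prop where
  smooth : ContDiff ℝ 3 g
  even : ∀ t : ℝ, g (-t) = g t
  global_decay : ∃ C : Fin 4 → ℝ, (∀ ℓ : Fin 4, 0 < C ℓ) ∧
    ∀ (ℓ : Fin 4) (t : ℝ), |iteratedDeriv ℓ g t| ≤ C ℓ / (1 + t ^ 2)
  eps_pos : 0 < ε
  beta_pos : 0 < β
  pos_near : ∀ t : ℝ, |t| ≤ ε → 0 < g t
  max_at_eps : ∀ t : ℝ, ε < |t| → g t < g ε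
  concave_near : ∀ t : ℝ, |t| ≤ ε → iteratedDeriv 2 g t < -β

namespace SpikeRecovery

theorem abs_tsum_le_tsum {ι : Type*} {f g : ι → ℝ} (hg : Summable g) (h : ∀ i, |f i| ≤ g i) :
    |∑' i, f i| ≤ ∑' i, g i := by
  rw [← Real.norm_eq_abs]
  exact tsum_of_norm_bounded hg.hasSum h

/-- The weight `1 / (1 + (k / s) ^ 2)`, sampled at scale `s`. -/
noncomputable def decay (s : ℝ) (k : ℤ) : ℝ := 1 / (1 + ((k : ℝ) / s) ^ 2)

theorem decay_pos (s : ℝ) (k : ℤ) : 0 < decay s k := by unfold decay; positivity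

theorem decay_nonneg (s : ℝ) (k : ℤ) : 0 ≤ decay s k := (decay_pos s k).le

theorem decay_zero (s : ℝ) : decay s 0 = 1 := by simp [decay]

theorem decay_neg (s : ℝ) (k : ℤ) : decay s (-k) = decay s k := by
  unfold decay; push_cast; rw [neg_div, neg_sq]

theorem decay_succ_le {s : ℝ} (hs : 0 < s) (n : ℕ) :
    decay s ((n + 1 : ℕ) : ℤ) ≤
      s * Real.arctan (((n + 1 : ℕ) : ℝ) / s) - s * Real.arctan ((n : ℝ) / s) := by
  have hlt : (n : ℝ) / s < ((n + 1 : ℕ) : ℝ) / s := by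
    push_cast; gcongr; linarith
  obtain ⟨c, hc, h⟩ := exists_deriv_eq_slope Real.arctan hlt
    Real.continuous_arctan.continuousOn Real.differentiable_arctan.differentiableOn
  have hd : ((n + 1 : ℕ) : ℝ) / s - (n : ℝ) / s = 1 / s := by push_cast; ring
  rw [Real.deriv_arctan, hd, div_div_eq_mul_div, div_one] at h
  have hc0 : 0 ≤ c := le_trans (by positivity) hc.1.le
  have : decay s ((n + 1 : ℕ) : ℤ) ≤ 1 / (1 + c ^ 2) := by
    unfold decay
    have := hc.2.le
    push_cast at this ⊢
    gcongr
  linarith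

theorem sum_range_decay_succ_le {s : ℝ} (hs : 0 < s) (n : ℕ) :
    ∑ i ∈ Finset.range n, decay s ((i + 1 : ℕ) : ℤ) ≤ s * (Real.pi / 2) := by
  calc _ ≤ ∑ i ∈ Finset.range n,
        (s * Real.arctan (((i + 1 : ℕ) : ℝ) / s) - s * Real.arctan ((i : ℝ) / s)) :=
        Finset.sum_le_sum fun i _ => decay_succ_le hs i
    _ = s * Real.arctan ((n : ℝ) / s) - s * Real.arctan (((0 : ℕ) : ℝ) / s) :=
        Finset.sum_range_sub (fun i : ℕ => s * Real.arctan ((i : ℝ) / s)) n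
    _ ≤ s * (Real.pi / 2) := by
        simp only [Nat.cast_zero, zero_div, Real.arctan_zero, mul_zero, sub_zero]
        exact mul_le_mul_of_nonneg_left (Real.arctan_lt_pi_div_two _).le hs.le

theorem summable_decay_succ {s : ℝ} (hs : 0 < s) :
    Summable fun n : ℕ => decay s ((n + 1 : ℕ) : ℤ) :=
  summable_of_sum_range_le (fun _ => decay_nonneg _ _) (sum_range_decay_succ_le hs)

theorem summable_decay {s : ℝ} (hs : 0 < s) : Summable (decay s) := by
  have h : Summable fun n : ℕ => decay s n := (summable_nat_add_iff 1).1 (summable_decay_succ hs)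
  exact summable_int_iff_summable_nat_and_neg.2 ⟨h, by simpa only [decay_neg] using h⟩

theorem tsum_decay_le {s : ℝ} (hs : 0 < s) : ∑' k, decay s k ≤ 1 + Real.pi * s := by
  have h : Summable fun n : ℕ => decay s n := (summable_nat_add_iff 1).1 (summable_decay_succ hs)
  have h1 : ∑' n : ℕ, decay s ((n + 1 : ℕ) : ℤ) ≤ s * (Real.pi / 2) :=
    Real.tsum_le_of_sum_range_le (fun _ => decay_nonneg _ _) (sum_range_decay_succ_le hs)
  have h2 : (fun n : ℕ => decay s (-((n : ℤ) + 1))) = fun n : ℕ => decay s ((n + 1 : ℕ) : ℤ) := by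
    funext n; rw [decay_neg]; push_cast; rfl
  rw [tsum_of_nat_of_neg_add_one h (by rw [h2]; exact summable_decay_succ hs), h2,
    h.tsum_eq_zero_add]
  simp only [Nat.cast_zero, decay_zero]
  linarith

theorem summable_decay_sub {s : ℝ} (hs : 0 < s) (k : ℤ) : Summable fun j => decay s (k - j) :=
  (Equiv.subLeft k).summable_iff.2 (summable_decay hs)

theorem decay_mul_decay_le (s : ℝ) (j k : ℤ) :
    decay s j * decay s (k - j) ≤ 2 * decay s k * (decay s j + decay s (k - j)) := by
  unfold decay
  have hk : (k : ℝ) / s = (j : ℝ) / s + ((k - j : ℤ) : ℝ) / s := by push_cast; ring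
  rw [hk]
  generalize (j : ℝ) / s = x
  generalize ((k - j : ℤ) : ℝ) / s = y
  rw [div_add_div _ _ (by positivity) (by positivity), mul_one_div, mul_one_div, div_mul_div_comm,
    div_div, div_le_div_iff₀ (by positivity) (by positivity)]
  have : 1 + (x + y) ^ 2 ≤ 2 * (2 + x ^ 2 + y ^ 2) := by nlinarith [sq_nonneg (x - y)]
  have h0 : 0 ≤ (1 + x ^ 2) * (1 + y ^ 2) := by positivity
  nlinarith [mul_le_mul_of_nonneg_right this h0]

theorem summable_decay_mul_decay {s : ℝ} (hs : 0 < s) (k : ℤ) :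
    Summable fun j => decay s j * decay s (k - j) :=
  Summable.of_nonneg_of_le (fun _ => mul_nonneg (decay_nonneg _ _) (decay_nonneg _ _))
    (fun j => decay_mul_decay_le s j k)
    (((summable_decay hs).add (summable_decay_sub hs k)).mul_left _)

theorem tsum_decay_mul_decay_le {s : ℝ} (hs : 0 < s) (k : ℤ) :
    ∑' j, decay s j * decay s (k - j) ≤ 4 * (1 + Real.pi * s) * decay s k := by
  calc _ ≤ ∑' j, 2 * decay s k * (decay s j + decay s (k - j)) :=
        (summable_decay_mul_decay hs k).tsum_le_tsum (fun j => decay_mul_decay_le s j k)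
          (((summable_decay hs).add (summable_decay_sub hs k)).mul_left _)
    _ = 2 * decay s k * (∑' j, decay s j + ∑' j, decay s j) := by
        rw [tsum_mul_left, (summable_decay hs).tsum_add (summable_decay_sub hs k)]
        congr 2
        exact (Equiv.subLeft k).tsum_eq (decay s)
    _ ≤ _ := by nlinarith [tsum_decay_le hs, decay_pos s k]

theorem one_div_one_add_sq_le (t h : ℝ) {ε : ℝ} (hh : |h| ≤ ε) :
    1 / (1 + (t + h) ^ 2) ≤ (2 + 2 * ε ^ 2) * (1 / (1 + t ^ 2)) := by
  rw [mul_one_div, div_le_div_iff₀ (by positivity) (by positivity)]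
  have h2 : h ^ 2 ≤ ε ^ 2 := sq_le_sq' (abs_le.1 hh).1 (abs_le.1 hh).2
  nlinarith [sq_nonneg (t + 2 * h), sq_nonneg (t + h),
    mul_nonneg (sq_nonneg ε) (sq_nonneg (t + h)), sq_nonneg h]

theorem decay_add_le {s ε : ℝ} (k r : ℤ) (hr : |(r : ℝ) / s| ≤ ε) :
    decay s (k + r) ≤ (2 + 2 * ε ^ 2) * decay s k := by
  have := one_div_one_add_sq_le ((k : ℝ) / s) ((r : ℝ) / s) hr
  rw [← add_div] at this
  unfold decay; push_cast; exact this

/-- The value of the lattice sum that controls the interaction of separated spikes. -/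
noncomputable def tailConst : ℝ := ∑' n : ℤ, 16 / (|(n : ℝ)| + 1) ^ 2

theorem summable_tailConst : Summable fun n : ℤ => 16 / (|(n : ℝ)| + 1) ^ 2 := by
  have h := (Real.summable_one_div_int_pow (p := 2)).2 one_lt_two
  refine Summable.of_norm_bounded_eventually (h.mul_left 16) ?_
  filter_upwards [(Set.finite_singleton (0 : ℤ)).compl_mem_cofinite] with n hn
  have hn : (n : ℝ) ≠ 0 := by exact_mod_cast hn
  rw [Real.norm_of_nonneg (by positivity), mul_one_div, ← sq_abs (n : ℝ)]
  have := abs_pos.2 hn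
  gcongr
  linarith

theorem tailConst_nonneg : 0 ≤ tailConst := tsum_nonneg fun _ => by positivity

/-- Distinct points of `K` are at distance at least `L`. -/
def Separated (K : Set ℤ) (L : ℝ) : Prop :=
  ∀ i ∈ K, ∀ j ∈ K, i ≠ j → L ≤ |(i : ℝ) - (j : ℝ)|

theorem quarter_abs_floor_le {a : ℝ} (ha : 1 / 2 ≤ |a|) : (|(⌊a⌋ : ℝ)| + 1) / 4 ≤ |a| := by
  have h1 := Int.floor_le a
  have h2 := Int.lt_floor_add_one a
  rcases le_or_gt 0 a with h | h
  · have : (0 : ℝ) ≤ ⌊a⌋ := by exact_mod_cast Int.floor_nonneg.2 h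
    rw [abs_of_nonneg h] at ha ⊢
    rw [abs_of_nonneg this]
    linarith
  · have : (⌊a⌋ : ℝ) < 0 := by linarith
    rw [abs_of_neg h] at ha ⊢
    rw [abs_of_neg this]
    have hz : ⌊a⌋ < 0 := by exact_mod_cast this
    rcases (show ⌊a⌋ = -1 ∨ ⌊a⌋ ≤ -2 by omega) with h3 | h3
    · rw [h3]; push_cast; linarith
    · have : (⌊a⌋ : ℝ) ≤ -2 := by exact_mod_cast h3
      linarith

open Classical in
/-- The indicator of the points of `K` at distance at least `L` from `k`. -/
noncomputable def awayIndicator (K : Set ℤ) (L : ℝ) (k m : ℤ) : ℝ :=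
  if m ∈ K ∧ L ≤ |(k : ℝ) - m| then 1 else 0

theorem awayIndicator_nonneg (K : Set ℤ) (L : ℝ) (k m : ℤ) : 0 ≤ awayIndicator K L k m := by
  unfold awayIndicator; split_ifs <;> norm_num

theorem sum_awayIndicator_mul_decay_le {K : Set ℤ} {s ν : ℝ} (hs : 0 < s) (hν : 0 < ν)
    (hK : Separated K (ν * s)) (k : ℤ) (T : Finset ℤ) :
    ∑ m ∈ T, awayIndicator K (ν * s / 2) k m * decay s (k - m) ≤ tailConst / ν ^ 2 := by
  classical
  set f : ℤ → ℤ := fun m => ⌊((k : ℝ) - m) / (ν * s)⌋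
  have hL : 0 < ν * s := mul_pos hν hs
  set T' := T.filter fun m => m ∈ K ∧ ν * s / 2 ≤ |(k : ℝ) - m|
  have hinj : Set.InjOn f T' := by
    intro a ha b hb hab
    simp only [T', Finset.coe_filter, Set.mem_ofPred_eq] at ha hb
    by_contra hne
    have h1 := hK a ha.2.1 b hb.2.1 hne
    have h2 := Int.abs_sub_lt_one_of_floor_eq_floor hab
    have h3 : ((k : ℝ) - a) / (ν * s) - ((k : ℝ) - b) / (ν * s) = (b - a) / (ν * s) := by ring
    rw [h3, abs_div, abs_of_pos hL, div_lt_one hL, abs_sub_comm] at h2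
    linarith
  calc _ = ∑ m ∈ T', decay s (k - m) := by
        rw [Finset.sum_filter]
        refine Finset.sum_congr rfl fun m _ => ?_
        unfold awayIndicator; split_ifs <;> simp
    _ ≤ ∑ m ∈ T', 16 / (|((f m : ℤ) : ℝ)| + 1) ^ 2 / ν ^ 2 := by
        refine Finset.sum_le_sum fun m hm => ?_
        simp only [T', Finset.mem_filter] at hm
        have h1 : 1 / 2 ≤ |((k : ℝ) - m) / (ν * s)| := by
          rw [abs_div, abs_of_pos hL, le_div_iff₀ hL]; linarith [hm.2.2]
        have h2 := quarter_abs_floor_le h1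
        set A : ℝ := |((f m : ℤ) : ℝ)| + 1
        have hA : 0 < A := by positivity
        have h3 : (A / 4) ^ 2 * ν ^ 2 ≤ (((k : ℝ) - m) / s) ^ 2 := by
          have : ((k : ℝ) - m) / s = ((k : ℝ) - m) / (ν * s) * ν := by field_simp
          rw [this, mul_pow, ← sq_abs (((k : ℝ) - m) / (ν * s))]
          gcongr
        unfold decay
        push_cast
        rw [div_div, div_le_div_iff₀ (by positivity) (by positivity)]
        nlinarith
    _ = ∑ n ∈ T'.image f, 16 / (|(n : ℝ)| + 1) ^ 2 / ν ^ 2 :=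
        (Finset.sum_image (f := fun n : ℤ => 16 / (|(n : ℝ)| + 1) ^ 2 / ν ^ 2) hinj).symm
    _ = (∑ n ∈ T'.image f, 16 / (|(n : ℝ)| + 1) ^ 2) / ν ^ 2 := by rw [Finset.sum_div]
    _ ≤ _ := by
        gcongr
        exact summable_tailConst.sum_le_tsum _ fun _ _ => by positivity

theorem summable_awayIndicator_mul_decay {s : ℝ} (hs : 0 < s) (K : Set ℤ) (L : ℝ) (k : ℤ) :
    Summable fun m => awayIndicator K L k m * decay s (k - m) := by
  refine Summable.of_nonneg_of_le
    (fun _ => mul_nonneg (awayIndicator_nonneg _ _ _ _) (decay_nonneg _ _)) (fun m => ?_)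
    (summable_decay_sub hs k)
  unfold awayIndicator; split_ifs <;> simp [decay_nonneg]

theorem tsum_awayIndicator_mul_decay_le {K : Set ℤ} {s ν : ℝ} (hs : 0 < s) (hν : 0 < ν)
    (hK : Separated K (ν * s)) (k : ℤ) :
    ∑' m, awayIndicator K (ν * s / 2) k m * decay s (k - m) ≤ tailConst / ν ^ 2 :=
  Real.tsum_le_of_sum_le
    (fun _ => mul_nonneg (awayIndicator_nonneg _ _ _ _) (decay_nonneg _ _))
    (sum_awayIndicator_mul_decay_le hs hν hK k)

/-- Discrete convolution on `ℤ`. -/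
noncomputable def conv (u v : ℤ → ℝ) (k : ℤ) : ℝ := ∑' j, u j * v (k - j)

theorem conv_comm (u v : ℤ → ℝ) : conv u v = conv v u := by
  funext k
  unfold conv
  rw [← (Equiv.subLeft k).tsum_eq]
  simp [mul_comm]

theorem summable_mul_of_bdd {ι : Type*} {u b : ι → ℝ} (hu : Summable u) {B : ℝ}
    (hb : ∀ k, |b k| ≤ B) : Summable fun j => u j * b j := by
  refine Summable.of_norm_bounded (hu.abs.mul_right B) fun j => ?_
  rw [norm_mul]
  exact mul_le_mul_of_nonneg_left (hb j) (abs_nonneg _)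

theorem exists_bound_of_summable {u : ℤ → ℝ} (hu : Summable u) : ∃ B, ∀ k, |u k| ≤ B :=
  ⟨∑' k, |u k|, fun k => hu.abs.le_tsum k fun _ _ => abs_nonneg _⟩

theorem summable_conv_uncurry {u v b : ℤ → ℝ} (hu : Summable u) (hv : Summable v) {B : ℝ}
    (hb : ∀ k, |b k| ≤ B) :
    Summable fun p : ℤ × ℤ => u p.2 * v (p.1 - p.2) * b p.1 := by
  have h1 : Summable fun p : ℤ × ℤ => u p.1 * v p.2 :=
    (Summable.mul_norm hu.norm hv.norm).of_norm
  let e : ℤ × ℤ ≃ ℤ × ℤ :=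
    { toFun := fun p => (p.2, p.1 - p.2)
      invFun := fun p => (p.1 + p.2, p.1)
      left_inv := fun p => by simp
      right_inv := fun p => by simp }
  exact summable_mul_of_bdd (b := fun p : ℤ × ℤ => b p.1) (e.summable_iff.2 h1) fun p => hb p.1

theorem summable_conv {u v : ℤ → ℝ} (hu : Summable u) (hv : Summable v) :
    Summable (conv u v) := by
  have h := summable_conv_uncurry hu hv (b := fun _ => 1) (B := 1) (by simp)
  have h' := h.prod
  simp only [mul_one] at h'
  exact h'

theorem conv_assoc {u v b : ℤ → ℝ} (hu : Summable u) (hv : Summable v) {B : ℝ}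
    (hb : ∀ k, |b k| ≤ B) : conv u (conv v b) = conv (conv u v) b := by
  funext k
  have h := summable_conv_uncurry hu hv (b := fun n => b (k - n)) (fun n => hb (k - n))
  calc conv u (conv v b) k = ∑' j, ∑' n, u j * v (n - j) * b (k - n) := by
        refine tsum_congr fun j => ?_
        unfold conv
        rw [← tsum_mul_left, ← (Equiv.subRight j).tsum_eq]
        refine tsum_congr fun n => ?_
        simp only [Equiv.subRight_apply]
        rw [mul_assoc]; congr 3; ring
    _ = ∑' n, ∑' j, u j * v (n - j) * b (k - n) :=
        Summable.tsum_comm (f := fun n j => u j * v (n - j) * b (k - n)) h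
    _ = _ := by
        refine tsum_congr fun n => ?_
        unfold conv
        rw [← tsum_mul_right]

theorem conv_sub_left {u v w : ℤ → ℝ} (hu : Summable u) (hv : Summable v) {B : ℝ}
    (hw : ∀ k, |w k| ≤ B) (k : ℤ) :
    conv (fun j => u j - v j) w k = conv u w k - conv v w k := by
  unfold conv
  rw [← (summable_mul_of_bdd hu fun j => hw (k - j)).tsum_sub
    (summable_mul_of_bdd hv fun j => hw (k - j))]
  exact tsum_congr fun j => by ring

theorem tsum_conv_mul_eq {w c h : ℤ → ℝ} (hw : Summable w) (heven : ∀ k, w (-k) = w k)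
    (hh : Summable h) {B : ℝ} (hc : ∀ k, |c k| ≤ B) :
    ∑' k, h k * conv w c k = ∑' j, conv h w j * c j := by
  have hh' : Summable fun k => h (-k) := (Equiv.neg ℤ).summable_iff.2 hh
  have key := congrFun (conv_assoc hh' hw hc) 0
  have h1 : conv (fun k => h (-k)) (conv w c) 0 = ∑' k, h k * conv w c k := by
    rw [conv, ← (Equiv.neg ℤ).tsum_eq]
    simp
  have h2 : ∀ j, conv (fun k => h (-k)) w j = conv h w (-j) := by
    intro j
    rw [conv, conv, ← (Equiv.neg ℤ).tsum_eq]
    refine tsum_congr fun i => ?_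
    simp only [Equiv.neg_apply, neg_neg]
    rw [← heven]; congr 2; ring
  have h3 : conv (conv (fun k => h (-k)) w) c 0 = ∑' j, conv h w j * c j := by
    rw [conv, ← (Equiv.neg ℤ).tsum_eq]
    refine tsum_congr fun i => ?_
    rw [h2]; simp
  rw [← h1, key, h3]

/-- A dual certificate bounds the mass of a competitor on the region where the certificate is
bounded away from one. -/
theorem tsum_far_le_of_certificate {w c x z : ℤ → ℝ} {F : Set ℤ} {B δ τ : ℝ}
    (hw : Summable w) (heven : ∀ k, w (-k) = w k) (hx : Summable x) (hz : Summable z)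
    (hc : ∀ k, |c k| ≤ B)
    (hle : ∀ k, |conv w c k| ≤ 1) (hsign : ∀ k, x k * conv w c k = |x k|)
    (hfar : ∀ k ∈ F, |conv w c k| ≤ 1 - τ)
    (hnorm : ∑' k, |z k| ≤ ∑' k, |x k|)
    (hδ : ∑' k, |conv x w k - conv z w k| ≤ δ) :
    τ * ∑' k : F, |z k| ≤ δ * B := by
  obtain ⟨W, hW⟩ := exists_bound_of_summable hw
  have hB : 0 ≤ B := (abs_nonneg _).trans (hc 0)
  set Q := conv w c
  have hh : Summable fun k => x k - z k := hx.sub hz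
  have hcs := summable_conv hh hw
  have hS : ∑' k, (x k - z k) * Q k ≤ δ * B := by
    rw [tsum_conv_mul_eq hw heven hh hc]
    refine (le_abs_self _).trans ((abs_tsum_le_tsum (hcs.abs.mul_right B) fun j => ?_).trans ?_)
    · rw [abs_mul]; exact mul_le_mul_of_nonneg_left (hc j) (abs_nonneg _)
    · rw [tsum_mul_right]
      refine mul_le_mul_of_nonneg_right (le_trans (le_of_eq ?_) hδ) hB
      exact tsum_congr fun k => by rw [conv_sub_left hx hz hW]
  have hFs : Summable (F.indicator fun k => |z k|) := hz.abs.indicator F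
  have hlow : ∑' k, (|x k| - |z k| + τ * F.indicator (fun k => |z k|) k) ≤
      ∑' k, (x k - z k) * Q k := by
    refine Summable.tsum_le_tsum (fun k => ?_) ((hx.abs.sub hz.abs).add (hFs.mul_left τ))
      (summable_mul_of_bdd hh hle)
    rw [sub_mul, hsign]
    have h1 : z k * Q k ≤ |z k| * |Q k| := by rw [← abs_mul]; exact le_abs_self _
    by_cases hk : k ∈ F
    · rw [Set.indicator_of_mem hk]
      nlinarith [mul_le_mul_of_nonneg_left (hfar k hk) (abs_nonneg (z k))]
    · rw [Set.indicator_of_notMem hk]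
      nlinarith [mul_le_mul_of_nonneg_left (hle k) (abs_nonneg (z k))]
  rw [(hx.abs.sub hz.abs).tsum_add (hFs.mul_left τ), hx.abs.tsum_sub hz.abs, tsum_mul_left,
    ← tsum_subtype F fun k => |z k|] at hlow
  linarith

/-- A small perturbation of the identity on bounded families is onto. -/
theorem exists_solution_of_small_rows {ι : Type*} (A : ι → ι → ℝ) (v : ι → ℝ) {θ : ℝ}
    (hθ : θ ≤ 1 / 2) (hA : ∀ i, Summable (A i)) (hrow : ∀ i, ∑' j, |A i j| ≤ θ)
    (hv : ∀ i, |v i| ≤ 1) :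
    ∃ a : ι → ℝ, (∀ i, a i + ∑' j, A i j * a j = v i) ∧ (∀ i, |a i| ≤ 2) ∧
      ∀ i, |a i - v i| ≤ 2 * θ := by
  rcases isEmpty_or_nonempty ι with hι | ⟨⟨i₀⟩⟩
  · exact ⟨v, fun i => hι.elim i, fun i => hι.elim i, fun i => hι.elim i⟩
  have hθ0 : 0 ≤ θ := (tsum_nonneg fun _ => abs_nonneg _).trans (hrow i₀)
  let _ : TopologicalSpace ι := ⊥
  have _ : DiscreteTopology ι := ⟨rfl⟩
  have hsum : ∀ (i : ι) (b : ι → ℝ) (M : ℝ), 0 ≤ M → (∀ j, |b j| ≤ M) →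
      |∑' j, A i j * b j| ≤ θ * M := by
    intro i b M hM hb
    refine (abs_tsum_le_tsum ((hA i).abs.mul_right M) fun j => ?_).trans ?_
    · rw [abs_mul]; exact mul_le_mul_of_nonneg_left (hb j) (abs_nonneg _)
    · rw [tsum_mul_right]; exact mul_le_mul_of_nonneg_right (hrow i) hM
  let Φ : BoundedContinuousFunction ι ℝ → BoundedContinuousFunction ι ℝ := fun a =>
    BoundedContinuousFunction.ofNormedAddCommGroupDiscrete (fun i => v i - ∑' j, A i j * a j)
      (1 + θ * ‖a‖) (fun i => (abs_sub _ _).trans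
        (add_le_add (hv i) (hsum i a ‖a‖ (norm_nonneg _) a.norm_coe_le_norm)))
  have hΦ : ∀ a i, Φ a i = v i - ∑' j, A i j * a j := fun _ _ => rfl
  have hcontr : ContractingWith (1 / 2) Φ := by
    refine ⟨by rw [← NNReal.coe_lt_coe]; norm_num, LipschitzWith.of_dist_le_mul fun a b => ?_⟩
    rw [BoundedContinuousFunction.dist_le (by positivity)]
    intro i
    rw [hΦ, hΦ, Real.dist_eq]
    have : v i - ∑' j, A i j * a j - (v i - ∑' j, A i j * b j) = ∑' j, A i j * (b j - a j) := by
      simp_rw [mul_sub]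
      rw [(summable_mul_of_bdd (hA i) b.norm_coe_le_norm).tsum_sub
        (summable_mul_of_bdd (hA i) a.norm_coe_le_norm)]
      ring
    rw [this]
    refine (hsum i _ (dist a b) dist_nonneg fun j => ?_).trans ?_
    · rw [← Real.dist_eq, dist_comm]; exact BoundedContinuousFunction.dist_coe_le_dist j
    · push_cast; exact mul_le_mul_of_nonneg_right hθ dist_nonneg
  obtain ⟨a, ha⟩ : ∃ a, Φ a = a := ⟨_, hcontr.fixedPoint_isFixedPt⟩
  have ha' : ∀ i, a i + ∑' j, A i j * a j = v i := fun i => by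
    have := hΦ a i
    rw [ha] at this
    linarith
  have hnorm : ‖a‖ ≤ 2 := by
    have : ‖a‖ ≤ 1 + θ * ‖a‖ := by
      rw [BoundedContinuousFunction.norm_le (by positivity)]
      intro i
      have h1 := hsum i a ‖a‖ (norm_nonneg _) a.norm_coe_le_norm
      have h2 : a i = v i - ∑' j, A i j * a j := by linarith [ha' i]
      rw [h2]
      exact (abs_sub _ _).trans (add_le_add (hv i) h1)
    nlinarith [norm_nonneg a]
  have hab : ∀ i, |a i| ≤ 2 := fun i => (a.norm_coe_le_norm i).trans hnorm
  refine ⟨a, ha', hab, fun i => ?_⟩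
  have h2 : a i - v i = -∑' j, A i j * a j := by linarith [ha' i]
  rw [h2, abs_neg, mul_comm]
  exact hsum i a 2 (by norm_num) hab

theorem awayIndicator_of_near {K : Set ℤ} {L : ℝ} (hK : Separated K L) {k m₀ m : ℤ}
    (hm₀ : m₀ ∈ K) (hk : |(k : ℝ) - m₀| < L / 2) (hm : m ∈ K) :
    awayIndicator K (L / 2) k m = if m = m₀ then 0 else 1 := by
  unfold awayIndicator
  by_cases h : m = m₀
  · subst h
    rw [if_neg fun h' => absurd h'.2 (not_le.2 hk), if_pos rfl]
  · rw [if_neg h, if_pos]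
    refine ⟨hm, ?_⟩
    have h1 := hK m hm m₀ hm₀ h
    have h2 := abs_sub_le (m : ℝ) k m₀
    rw [abs_sub_comm (m : ℝ) k] at h2
    linarith

section

variable {K : Set ℤ} {s ν M : ℝ} {a G : ℤ → ℝ}

theorem summable_away_mul (hs : 0 < s) (L : ℝ) (hG : ∀ k, |G k| ≤ M * decay s k) (k : ℤ) :
    Summable fun m => awayIndicator K L k m * G (k - m) := by
  refine Summable.of_norm_bounded ((summable_awayIndicator_mul_decay hs K L k).mul_left M)
    fun m => ?_
  rw [norm_mul, Real.norm_of_nonneg (awayIndicator_nonneg _ _ _ _), Real.norm_eq_abs]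
  nlinarith [mul_le_mul_of_nonneg_left (hG (k - m)) (awayIndicator_nonneg K L k m)]

theorem tsum_abs_away_mul_le (hs : 0 < s) (hν : 0 < ν) (hK : Separated K (ν * s)) (hM : 0 ≤ M)
    (hG : ∀ k, |G k| ≤ M * decay s k) (k : ℤ) :
    ∑' m, |awayIndicator K (ν * s / 2) k m * G (k - m)| ≤ M * (tailConst / ν ^ 2) := by
  refine (Summable.tsum_le_tsum (fun m => ?_) (summable_away_mul hs _ hG k).abs
    ((summable_awayIndicator_mul_decay hs K (ν * s / 2) k).mul_left M)).trans ?_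
  · rw [abs_mul, abs_of_nonneg (awayIndicator_nonneg _ _ _ _)]
    nlinarith [mul_le_mul_of_nonneg_left (hG (k - m)) (awayIndicator_nonneg K (ν * s / 2) k m)]
  · rw [tsum_mul_left]
    exact mul_le_mul_of_nonneg_left (tsum_awayIndicator_mul_decay_le hs hν hK k) hM

theorem abs_tsum_away_mul_le (hs : 0 < s) (hν : 0 < ν) (hK : Separated K (ν * s)) (hM : 0 ≤ M)
    (hG : ∀ k, |G k| ≤ M * decay s k) {C : ℝ} (ha : ∀ m, |a m| ≤ C) (k : ℤ) :
    |∑' m, awayIndicator K (ν * s / 2) k m * G (k - m) * a m| ≤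
      M * (tailConst / ν ^ 2) * C := by
  have hC : 0 ≤ C := (abs_nonneg _).trans (ha 0)
  refine (abs_tsum_le_tsum
    ((summable_away_mul (K := K) hs (ν * s / 2) hG k).abs.mul_right C) fun m => ?_).trans ?_
  · rw [abs_mul]; exact mul_le_mul_of_nonneg_left (ha m) (abs_nonneg _)
  · rw [tsum_mul_right]
    exact mul_le_mul_of_nonneg_right (tsum_abs_away_mul_le hs hν hK hM hG k) hC

/-- Near a point of `K`, a superposition of translates of `G` is the nearest translate plus the
contribution of the distant ones. -/
theorem conv_eq_near_add (hs : 0 < s) (hK : Separated K (ν * s))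
    (hG : ∀ k, |G k| ≤ M * decay s k) {C : ℝ} (ha : ∀ m, |a m| ≤ C) (ha0 : ∀ m, m ∉ K → a m = 0)
    {k m₀ : ℤ} (hm₀ : m₀ ∈ K) (hk : |(k : ℝ) - m₀| < ν * s / 2) :
    conv a G k = a m₀ * G (k - m₀) +
      ∑' m, awayIndicator K (ν * s / 2) k m * G (k - m) * a m := by
  have h : ∀ m, a m * G (k - m) = (if m = m₀ then a m₀ * G (k - m₀) else 0) +
      awayIndicator K (ν * s / 2) k m * G (k - m) * a m := by
    intro m
    by_cases hm : m ∈ K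
    · rw [awayIndicator_of_near hK hm₀ hk hm]
      by_cases h : m = m₀
      · subst h; rw [if_pos rfl, if_pos rfl]; ring
      · rw [if_neg h, if_neg h]; ring
    · have : m ≠ m₀ := fun h => hm (h ▸ hm₀)
      rw [ha0 m hm, if_neg this]; ring
  rw [conv, tsum_congr h, Summable.tsum_add ((hasSum_ite_eq m₀ _).summable)
    (summable_mul_of_bdd (summable_away_mul hs _ hG k) ha), tsum_ite_eq]

theorem abs_conv_sub_near_le (hs : 0 < s) (hν : 0 < ν) (hK : Separated K (ν * s)) (hM : 0 ≤ M)
    (hG : ∀ k, |G k| ≤ M * decay s k) {C : ℝ} (ha : ∀ m, |a m| ≤ C) (ha0 : ∀ m, m ∉ K → a m = 0)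
    {k m₀ : ℤ} (hm₀ : m₀ ∈ K) (hk : |(k : ℝ) - m₀| < ν * s / 2) :
    |conv a G k - a m₀ * G (k - m₀)| ≤ M * (tailConst / ν ^ 2) * C := by
  rw [conv_eq_near_add hs hK hG ha ha0 hm₀ hk, add_sub_cancel_left]
  exact abs_tsum_away_mul_le hs hν hK hM hG ha k

theorem abs_conv_le_of_away (hs : 0 < s) (hν : 0 < ν) (hK : Separated K (ν * s)) (hM : 0 ≤ M)
    (hG : ∀ k, |G k| ≤ M * decay s k) {C : ℝ} (ha : ∀ m, |a m| ≤ C) (ha0 : ∀ m, m ∉ K → a m = 0)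
    {k : ℤ} (hk : ∀ m ∈ K, ν * s / 2 ≤ |(k : ℝ) - m|) :
    |conv a G k| ≤ M * (tailConst / ν ^ 2) * C := by
  have h : conv a G k = ∑' m, awayIndicator K (ν * s / 2) k m * G (k - m) * a m := by
    refine tsum_congr fun m => ?_
    by_cases hm : m ∈ K
    · unfold awayIndicator
      rw [if_pos ⟨hm, hk m hm⟩]; ring
    · rw [ha0 m hm, zero_mul, mul_zero]
  rw [h]
  exact abs_tsum_away_mul_le hs hν hK hM hG ha k

theorem abs_conv_le_of_forall_abs_le (hs : 0 < s) (hν : 0 < ν) (hK : Separated K (ν * s))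
    (hM : 0 ≤ M) (hG : ∀ k, |G k| ≤ M * decay s k) {B : ℝ} (hB : 0 ≤ B) (hGB : ∀ k, |G k| ≤ B)
    {C : ℝ} (ha : ∀ m, |a m| ≤ C) (ha0 : ∀ m, m ∉ K → a m = 0) (k : ℤ) :
    |conv a G k| ≤ (B + M * (tailConst / ν ^ 2)) * C := by
  have hC : 0 ≤ C := (abs_nonneg _).trans (ha 0)
  by_cases h : ∃ m ∈ K, |(k : ℝ) - m| < ν * s / 2
  · obtain ⟨m₀, hm₀, hk⟩ := h
    have h1 := abs_conv_sub_near_le hs hν hK hM hG ha ha0 hm₀ hk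
    have h2 : |a m₀ * G (k - m₀)| ≤ C * B := by
      rw [abs_mul]; exact mul_le_mul (ha _) (hGB _) (abs_nonneg _) hC
    have h3 := abs_sub_abs_le_abs_sub (conv a G k) (a m₀ * G (k - m₀))
    linarith
  · push Not at h
    have := abs_conv_le_of_away hs hν hK hM hG ha ha0 h
    nlinarith [mul_nonneg hB hC]

end

theorem tsum_abs_elim_le {ι κ : Type*} {f : ι → ℝ} {f' : κ → ℝ} (hf : Summable f)
    (hf' : Summable f') {p q : ℝ} (hp : ∑' i, |f i| ≤ p) (hq : ∑' i, |f' i| ≤ q) :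
    ∑' j, |Sum.elim f f' j| ≤ p + q := by
  have h := Summable.tsum_sum (f := fun j => |Sum.elim f f' j|) hf.abs hf'.abs
  rw [h]
  exact add_le_add hp hq

theorem tsum_elim_mul {ι κ : Type*} {f : ι → ℝ} {f' : κ → ℝ} (hf : Summable f)
    (hf' : Summable f') {c : ι ⊕ κ → ℝ} {C : ℝ} (hc : ∀ j, |c j| ≤ C) :
    ∑' j, Sum.elim f f' j * c j = ∑' i, f i * c (Sum.inl i) + ∑' i, f' i * c (Sum.inr i) :=
  Summable.tsum_sum (f := fun j => Sum.elim f f' j * c j)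
    (summable_mul_of_bdd hf fun i => hc (Sum.inl i))
    (summable_mul_of_bdd hf' fun i => hc (Sum.inr i))

/-- Hermite interpolation on a well separated set by translates of `G` and `H`, where `G₁` and `H₁`
play the role of the derivatives of `G` and `H`. -/
theorem exists_interpolation {K : Set ℤ} {s ν M : ℝ} {G G₁ H H₁ v : ℤ → ℝ}
    (hs : 0 < s) (hν : 0 < ν) (hK : Separated K (ν * s)) (hM : 0 ≤ M)
    (hG : ∀ k, |G k| ≤ M * decay s k) (hG₁ : ∀ k, |G₁ k| ≤ M * decay s k)
    (hH : ∀ k, |H k| ≤ M * decay s k) (hH₁ : ∀ k, |H₁ k| ≤ M * decay s k)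
    (hG0 : G 0 = 1) (hG₁0 : G₁ 0 = 0) (hH0 : H 0 = 0) (hH₁0 : H₁ 0 = 1)
    (hsmall : 4 * (M * (tailConst / ν ^ 2)) ≤ 1)
    (hv : ∀ m, |v m| ≤ 1) (hv0 : ∀ m, m ∉ K → v m = 0) :
    ∃ a b : ℤ → ℝ, (∀ m, m ∉ K → a m = 0) ∧ (∀ m, m ∉ K → b m = 0) ∧
      (∀ m, |a m| ≤ 2) ∧ (∀ m, |b m| ≤ 4 * (M * (tailConst / ν ^ 2))) ∧
      (∀ m, |a m - v m| ≤ 4 * (M * (tailConst / ν ^ 2))) ∧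
      ∀ k ∈ K, conv a G k + conv b H k = v k ∧ conv a G₁ k + conv b H₁ k = 0 := by
  classical
  set t := M * (tailConst / ν ^ 2)
  have ht : 0 ≤ t := mul_nonneg hM (div_nonneg tailConst_nonneg (by positivity))
  let χ : ℤ → ℝ := K.indicator 1
  have hχ : ∀ k, |χ k| ≤ 1 := fun k => by
    by_cases h : k ∈ K <;> simp [χ, h]
  let B : (ℤ → ℝ) → ℤ → ℤ → ℝ := fun F k m =>
    χ k * (awayIndicator K (ν * s / 2) k m * F (k - m))
  have hBs : ∀ F : ℤ → ℝ, (∀ k, |F k| ≤ M * decay s k) → ∀ k, Summable (B F k) :=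
    fun F hF k => (summable_away_mul hs _ hF k).mul_left _
  have hBt : ∀ F : ℤ → ℝ, (∀ k, |F k| ≤ M * decay s k) → ∀ k, ∑' m, |B F k m| ≤ t := by
    intro F hF k
    simp only [B, abs_mul (χ k)]
    rw [tsum_mul_left]
    have h1 := tsum_abs_away_mul_le hs hν hK hM hF k
    have h2 : 0 ≤ ∑' m, |awayIndicator K (ν * s / 2) k m * F (k - m)| :=
      tsum_nonneg fun _ => abs_nonneg _
    exact (mul_le_of_le_one_left h2 (hχ k)).trans h1
  let A : ℤ ⊕ ℤ → ℤ ⊕ ℤ → ℝ := Sum.elim (fun k => Sum.elim (B G k) (B H k))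
    (fun k => Sum.elim (B G₁ k) (B H₁ k))
  have hA : ∀ i, Summable (A i) := by
    rintro (k | k)
    · exact Summable.sum _ (hBs G hG k) (hBs H hH k)
    · exact Summable.sum _ (hBs G₁ hG₁ k) (hBs H₁ hH₁ k)
  have hrow : ∀ i, ∑' j, |A i j| ≤ 2 * t := by
    rintro (k | k)
    · exact (tsum_abs_elim_le (hBs G hG k) (hBs H hH k) (hBt G hG k) (hBt H hH k)).trans_eq
        (two_mul t).symm
    · exact (tsum_abs_elim_le (hBs G₁ hG₁ k) (hBs H₁ hH₁ k) (hBt G₁ hG₁ k) (hBt H₁ hH₁ k)).trans_eq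
        (two_mul t).symm
  obtain ⟨c, hc, hc2, hcv⟩ := exists_solution_of_small_rows A (Sum.elim v fun _ => 0)
    (θ := 2 * t) (by linarith) hA hrow (by rintro (k | k) <;> simp [hv])
  have hsplit : ∀ (F F' : ℤ → ℝ), (∀ k, |F k| ≤ M * decay s k) → (∀ k, |F' k| ≤ M * decay s k) →
      ∀ k, ∑' j, Sum.elim (B F k) (B F' k) j * c j =
        χ k * (∑' m, awayIndicator K (ν * s / 2) k m * F (k - m) * c (Sum.inl m)) +
        χ k * (∑' m, awayIndicator K (ν * s / 2) k m * F' (k - m) * c (Sum.inr m)) := by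
    intro F F' hF hF' k
    rw [tsum_elim_mul (hBs F hF k) (hBs F' hF' k) hc2, ← tsum_mul_left, ← tsum_mul_left]
    congr 1 <;> exact tsum_congr fun m => by simp only [B]; ring
  have h1 : ∀ k, c (Sum.inl k) + _ = v k := fun k => (hsplit G H hG hH k) ▸ hc (Sum.inl k)
  have h2 : ∀ k, c (Sum.inr k) + _ = 0 := fun k => (hsplit G₁ H₁ hG₁ hH₁ k) ▸ hc (Sum.inr k)
  have ha0 : ∀ m, m ∉ K → c (Sum.inl m) = 0 := fun m hm => by
    have := h1 m
    simpa [χ, hm, hv0 m hm] using this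
  have hb0 : ∀ m, m ∉ K → c (Sum.inr m) = 0 := fun m hm => by
    have := h2 m
    simpa [χ, hm] using this
  refine ⟨fun m => c (Sum.inl m), fun m => c (Sum.inr m), ha0, hb0, fun m => hc2 _,
    fun m => ?_, fun m => ?_, fun k hk => ?_⟩
  · have := hcv (Sum.inr m)
    simp only [Sum.elim_inr, sub_zero] at this
    linarith
  · have := hcv (Sum.inl m)
    simp only [Sum.elim_inl] at this
    linarith
  · by_cases hs' : |(k : ℝ) - k| < ν * s / 2
    · rw [conv_eq_near_add hs hK hG (fun m => hc2 (Sum.inl m)) ha0 hk hs',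
        conv_eq_near_add hs hK hH (fun m => hc2 (Sum.inr m)) hb0 hk hs',
        conv_eq_near_add hs hK hG₁ (fun m => hc2 (Sum.inl m)) ha0 hk hs',
        conv_eq_near_add hs hK hH₁ (fun m => hc2 (Sum.inr m)) hb0 hk hs']
      have h3 := h1 k
      have h4 := h2 k
      simp only [χ, Set.indicator_of_mem hk, Pi.one_apply, one_mul] at h3 h4
      rw [sub_self, hG0, hG₁0, hH0, hH₁0]
      constructor <;> linarith
    · exact absurd (by rw [sub_self, abs_zero]; positivity) hs'

/-- The properties of a kernel `g` with derivatives `g₁`, `g₂` used to build dual certificates. -/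
structure Bump (g g₁ g₂ : ℝ → ℝ) (ε β C : ℝ) : Prop where
  even : ∀ t, g (-t) = g t
  odd : ∀ t, g₁ (-t) = -g₁ t
  hasDerivAt : ∀ t, HasDerivAt g (g₁ t) t
  hasDerivAt₁ : ∀ t, HasDerivAt g₁ (g₂ t) t
  abs_le : ∀ t, |g t| ≤ C / (1 + t ^ 2)
  abs_le₁ : ∀ t, |g₁ t| ≤ C / (1 + t ^ 2)
  abs_le₂ : ∀ t, |g₂ t| ≤ C / (1 + t ^ 2)
  eps_pos : 0 < ε
  beta_pos : 0 < β
  const_pos : 0 < C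
  pos : ∀ t, |t| ≤ ε → 0 < g t
  le_slope : ∀ t, 0 ≤ t → t ≤ ε → β * t ≤ -g₁ t
  le_drop : ∀ t v, 0 ≤ t → t ≤ ε → t ≤ v → β / 2 * (min v ε ^ 2 - t ^ 2) ≤ g t - g v

theorem exists_lt_concave {g : ℝ → ℝ} {ε β : ℝ} (hg : IsAdmissibleKernel g ε β) :
    ∃ β' > β, ∀ t, |t| ≤ ε → iteratedDeriv 2 g t ≤ -β' := by
  have hc : Continuous (iteratedDeriv 2 g) :=
    hg.smooth.continuous_iteratedDeriv 2 (by norm_num)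
  obtain ⟨t₀, ht₀, hmax⟩ := (isCompact_Icc (a := -ε) (b := ε)).exists_isMaxOn
    ⟨0, by constructor <;> linarith [hg.eps_pos]⟩ hc.continuousOn
  refine ⟨-iteratedDeriv 2 g t₀, ?_, fun t ht => ?_⟩
  · have := hg.concave_near t₀ (abs_le.2 ht₀); linarith
  · rw [neg_neg]; exact hmax (abs_le.1 ht)

theorem exists_bump {g : ℝ → ℝ} {ε β : ℝ} (hg : IsAdmissibleKernel g ε β) :
    ∃ β' > β, ∃ C, Bump g (deriv g) (deriv (deriv g)) ε β' C := by
  obtain ⟨β', hβ', hconc⟩ := exists_lt_concave hg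
  obtain ⟨C, hC, hbound⟩ := hg.global_decay
  have hε := hg.eps_pos
  have hβ0 : 0 < β' := hg.beta_pos.trans hβ'
  have h1 : Differentiable ℝ g := hg.smooth.differentiable (by norm_num)
  have h2 : Differentiable ℝ (deriv g) := by
    have := hg.smooth.differentiable_iteratedDeriv 1 (by norm_num)
    rwa [iteratedDeriv_one] at this
  have hit2 : iteratedDeriv 2 g = deriv (deriv g) := by
    rw [iteratedDeriv_succ, iteratedDeriv_one]
  have hodd : ∀ t, deriv g (-t) = -deriv g t := by
    intro t
    have h := (h1 (-t)).hasDerivAt.comp t (hasDerivAt_neg t)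
    have h' : g ∘ Neg.neg = g := funext fun t => hg.even t
    rw [h'] at h
    rw [h.deriv]; ring
  have hzero : deriv g 0 = 0 := by have := hodd 0; rw [neg_zero] at this; linarith
  have hslope : ∀ t, 0 ≤ t → t ≤ ε → β' * t ≤ -deriv g t := by
    have hanti : AntitoneOn (fun t => deriv g t + β' * t) (Set.Icc 0 ε) := by
      refine antitoneOn_of_hasDerivWithinAt_nonpos (f' := fun t => deriv (deriv g) t + β' * 1)
        (convex_Icc 0 ε)
        (h2.continuous.add (continuous_const.mul continuous_id)).continuousOn
        (fun t _ => (((h2 t).hasDerivAt).add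
          ((hasDerivAt_id t).const_mul β')).hasDerivWithinAt) fun t ht => ?_
      rw [interior_Icc] at ht
      have := hconc t (by rw [abs_of_pos ht.1]; exact ht.2.le)
      rw [hit2] at this
      linarith
    intro t ht0 ht
    have := hanti (Set.left_mem_Icc.2 hε.le) ⟨ht0, ht⟩ ht0
    simp only [hzero] at this
    linarith
  have hdrop : ∀ t u, 0 ≤ t → t ≤ u → u ≤ ε → β' / 2 * (u ^ 2 - t ^ 2) ≤ g t - g u := by
    have hanti : AntitoneOn (fun t => g t + β' / 2 * t ^ 2) (Set.Icc 0 ε) := by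
      refine antitoneOn_of_hasDerivWithinAt_nonpos
        (f' := fun t => deriv g t + β' / 2 * (2 * t ^ 1)) (convex_Icc 0 ε)
        (h1.continuous.add (continuous_const.mul (continuous_pow 2))).continuousOn
        (fun t _ => (((h1 t).hasDerivAt).add
          ((hasDerivAt_pow 2 t).const_mul (β' / 2))).hasDerivWithinAt) fun t ht => ?_
      rw [interior_Icc] at ht
      have := hslope t ht.1.le ht.2.le
      linarith
    intro t u ht0 htu hu
    have := hanti ⟨ht0, htu.trans hu⟩ ⟨ht0.trans htu, hu⟩ htu
    simp only at this
    linarith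
  refine ⟨β', hβ', C 0 + C 1 + C 2, hg.even, hodd, fun t => (h1 t).hasDerivAt,
    fun t => (h2 t).hasDerivAt, fun t => ?_, fun t => ?_, fun t => ?_, hε, hβ0,
    by linarith [hC 0, hC 1, hC 2], hg.pos_near, hslope, fun t v ht0 ht htv => ?_⟩
  · have := hbound 0 t
    refine (by simpa using this : |g t| ≤ C 0 / (1 + t ^ 2)).trans ?_
    gcongr; linarith [hC 1, hC 2]
  · have := hbound 1 t
    refine (by simpa using this : |deriv g t| ≤ C 1 / (1 + t ^ 2)).trans ?_
    gcongr; linarith [hC 0, hC 2]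
  · have := hbound 2 t
    rw [← hit2]
    refine this.trans ?_
    gcongr; linarith [hC 0, hC 1]
  · have hm := hdrop t (min v ε) ht0 (le_min htv ht) (min_le_right _ _)
    refine hm.trans (sub_le_sub_left ?_ _)
    rcases le_or_gt v ε with h | h
    · rw [min_eq_left h]
    · rw [min_eq_right h.le]
      exact (hg.max_at_eps v (by rwa [abs_of_pos (hε.trans h)])).le

theorem Bump.apply_abs {g g₁ g₂ : ℝ → ℝ} {ε β C : ℝ} (hb : Bump g g₁ g₂ ε β C)
    (t : ℝ) : g |t| = g t := by
  rcases abs_choice t with h | h <;> rw [h]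
  exact hb.even t

theorem Bump.le_drop_zero {g g₁ g₂ : ℝ → ℝ} {ε β C : ℝ} (hb : Bump g g₁ g₂ ε β C)
    (t : ℝ) : β / 2 * min |t| ε ^ 2 ≤ g 0 - g t := by
  have := hb.le_drop 0 |t| le_rfl hb.eps_pos.le (abs_nonneg t)
  rw [hb.apply_abs] at this
  linarith

theorem Bump.le_drop_mid {g g₁ g₂ : ℝ → ℝ} {ε β C : ℝ} (hb : Bump g g₁ g₂ ε β C)
    {t h : ℝ} (h1 : ε / 4 ≤ t) (h2 : t ≤ ε / 2) (hh : 0 ≤ h) :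
    β * ε / 4 * min h (ε / 2) ≤ g t - g (t + h) := by
  have hε := hb.eps_pos
  have hβ := hb.beta_pos
  have h3 := hb.le_drop t (t + h) (by linarith) (by linarith) (by linarith)
  set m := min h (ε / 2)
  have hm0 : 0 ≤ m := le_min hh (by linarith)
  have hm : t + m ≤ min (t + h) ε :=
    le_min (by linarith [min_le_left h (ε / 2)]) (by linarith [min_le_right h (ε / 2)])
  have hsq : (t + m) ^ 2 ≤ min (t + h) ε ^ 2 := pow_le_pow_left₀ (by linarith) hm 2
  have : β / 2 * (2 * t * m) ≤ β / 2 * (min (t + h) ε ^ 2 - t ^ 2) := by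
    gcongr; nlinarith
  nlinarith [mul_le_mul_of_nonneg_right h1 (mul_nonneg hβ.le hm0)]

/-- First-order Taylor estimate for functions with decaying second derivative. -/
theorem abs_sub_taylor_le {f f₁ f₂ : ℝ → ℝ} {ε C : ℝ} (h₁ : ∀ t, HasDerivAt f (f₁ t) t)
    (h₂ : ∀ t, HasDerivAt f₁ (f₂ t) t) (hC : ∀ t, |f₂ t| ≤ C / (1 + t ^ 2)) {t h : ℝ}
    (hh : |h| ≤ ε) :
    |f (t + h) - f t - h * f₁ t| ≤ (2 + 2 * ε ^ 2) * C * h ^ 2 / (1 + t ^ 2) := by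
  have hC0 : 0 ≤ C := by have := (abs_nonneg _).trans (hC 0); simpa using this
  set D := (2 + 2 * ε ^ 2) * C / (1 + t ^ 2)
  have hsecond : ∀ x, |x| ≤ ε → |f₂ (t + x)| ≤ D := by
    intro x hx
    refine (hC _).trans ?_
    have := mul_le_mul_of_nonneg_left (one_div_one_add_sq_le t x hx) hC0
    rw [mul_one_div] at this
    exact this.trans_eq (by simp only [D]; ring)
  have hD : 0 ≤ D := by positivity
  have hfirst : ∀ x ∈ Set.Icc (-|h|) |h|, |f₁ (t + x) - f₁ t| ≤ D * |h| := by
    intro x hx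
    have := (convex_Icc (-|h|) |h|).norm_image_sub_le_of_norm_hasDerivWithin_le
      (f := fun x => f₁ (t + x)) (f' := fun x => f₂ (t + x)) (C := D) (x := 0) (y := x)
      (fun y _ => ((h₂ (t + y)).comp_const_add t y).hasDerivWithinAt)
      (fun y hy => hsecond y ((abs_le.2 hy).trans hh))
      (by constructor <;> linarith [abs_nonneg h]) hx
    rw [add_zero, sub_zero, Real.norm_eq_abs, Real.norm_eq_abs] at this
    exact this.trans (mul_le_mul_of_nonneg_left (abs_le.2 hx) hD)
  have := (convex_Icc (-|h|) |h|).norm_image_sub_le_of_norm_hasDerivWithin_le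
      (f := fun x => f (t + x) - x * f₁ t) (f' := fun x => f₁ (t + x) - 1 * f₁ t)
      (C := D * |h|) (x := 0) (y := h)
      (fun y _ => (((h₁ (t + y)).comp_const_add t y).sub
        ((hasDerivAt_id y).mul_const (f₁ t))).hasDerivWithinAt)
      (fun y hy => by rw [one_mul]; exact hfirst y hy)
      (by constructor <;> linarith [abs_nonneg h]) (abs_le.1 le_rfl)
  rw [sub_zero, add_zero, zero_mul, sub_zero, Real.norm_eq_abs, Real.norm_eq_abs, mul_assoc,
    abs_mul_abs_self] at this
  calc _ = |f (t + h) - h * f₁ t - f t| := by congr 1; ring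
    _ ≤ _ := this
    _ = _ := by simp only [D]; ring

theorem summable_of_decay {s M : ℝ} {G : ℤ → ℝ} (hs : 0 < s) (hG : ∀ k, |G k| ≤ M * decay s k) :
    Summable G :=
  Summable.of_norm_bounded ((summable_decay hs).mul_left M) hG

theorem summable_bdd_mul_translate {a G : ℤ → ℝ} {C : ℝ} (hG : Summable G) (ha : ∀ m, |a m| ≤ C)
    (k : ℤ) : Summable fun m => a m * G (k - m) := by
  have := summable_mul_of_bdd ((Equiv.subLeft k).summable_iff.2 hG) ha
  simpa [mul_comm] using this

theorem decay_le_one (s : ℝ) (k : ℤ) : decay s k ≤ 1 := by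
  unfold decay
  rw [div_le_one (by positivity)]
  nlinarith [sq_nonneg ((k : ℝ) / s)]

theorem conv_taylor {a G G₁ : ℤ → ℝ} {C : ℝ} (hG : Summable G) (hG₁ : Summable G₁)
    (ha : ∀ m, |a m| ≤ C) (m κ : ℤ) (h : ℝ) :
    conv a (fun n => G (n + κ) - G n - h * G₁ n) m =
      conv a G (m + κ) - conv a G m - h * conv a G₁ m := by
  unfold conv
  have h1 := summable_bdd_mul_translate hG ha
  rw [← tsum_mul_left, ← (h1 _).tsum_sub (h1 _), ← ((h1 _).sub (h1 _)).tsum_sub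
    ((summable_bdd_mul_translate hG₁ ha m).mul_left h)]
  refine tsum_congr fun j => ?_
  simp only [sub_add_eq_add_sub]; ring

theorem abs_le_one_of_near_one {Q a u q h ε c τ : ℝ} (hE : |Q - (1 - a * u)| ≤ 10 * q * h ^ 2)
    (ha : |a - 1| ≤ 4 * q) (hu : u ≤ 2 - τ) (hc : c * h ^ 2 ≤ u) (hh : h ^ 2 ≤ ε ^ 2)
    (hq0 : 0 ≤ q) (hq1 : 28 * q ≤ 1) (hτ : 0 ≤ τ) (hqc : 20 * q ≤ c)
    (hqε : q * (8 + 10 * ε ^ 2) ≤ τ) : |Q| ≤ 1 := by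
  rw [abs_le] at hE ha ⊢
  have hqh : q * h ^ 2 ≤ q * ε ^ 2 := mul_le_mul_of_nonneg_left hh hq0
  have hch : 20 * q * h ^ 2 ≤ c * h ^ 2 := mul_le_mul_of_nonneg_right hqc (sq_nonneg h)
  have hqh0 : 0 ≤ q * h ^ 2 := mul_nonneg hq0 (sq_nonneg h)
  have hu0 : 0 ≤ u := by linarith
  have h1 : 1 / 2 * u ≤ a * u := mul_le_mul_of_nonneg_right (by linarith) hu0
  have h2 : a * u ≤ (1 + 4 * q) * u := mul_le_mul_of_nonneg_right (by linarith) hu0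
  have h3 : q * u ≤ q * 2 := mul_le_mul_of_nonneg_left (by linarith) hq0
  constructor <;> linarith

/-- Dual certificate by Hermite interpolation. -/
theorem exists_hermite_certificate {K : Set ℤ} {s ν M ε c τ q : ℝ} {G G₁ H H₁ v : ℤ → ℝ}
    (hs : 0 < s) (hε : 0 < ε) (hν : 2 * ε < ν) (hK : Separated K (ν * s)) (hM : 1 ≤ M)
    (hG : ∀ k, |G k| ≤ M * decay s k) (hG₁ : ∀ k, |G₁ k| ≤ M * decay s k)
    (hH : ∀ k, |H k| ≤ M * decay s k) (hH₁ : ∀ k, |H₁ k| ≤ M * decay s k)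
    (hG0 : G 0 = 1) (hG₁0 : G₁ 0 = 0) (hH0 : H 0 = 0) (hH₁0 : H₁ 0 = 1)
    (hGT : ∀ k κ : ℤ, |(κ : ℝ) / s| ≤ ε →
      |G (k + κ) - G k - (κ : ℝ) / s * G₁ k| ≤ M * ((κ : ℝ) / s) ^ 2 * decay s k)
    (hHT : ∀ k κ : ℤ, |(κ : ℝ) / s| ≤ ε →
      |H (k + κ) - H k - (κ : ℝ) / s * H₁ k| ≤ M * ((κ : ℝ) / s) ^ 2 * decay s k)
    (hτ : 0 < τ) (hτ1 : τ ≤ 1)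
    (hcurv : ∀ κ : ℤ, |(κ : ℝ) / s| ≤ ε → c * ((κ : ℝ) / s) ^ 2 ≤ 1 - G κ)
    (hlow : ∀ κ : ℤ, τ ≤ 1 + G κ)
    (hfar : ∀ κ : ℤ, ε < |(κ : ℝ) / s| → G κ ≤ 1 - τ)
    (hq : M ^ 2 * (tailConst / ν ^ 2) = q)
    (hqc : 20 * q ≤ c) (hqτ : 28 * q ≤ τ) (hqε : q * (8 + 10 * ε ^ 2) ≤ τ)
    (hv : ∀ m ∈ K, |v m| = 1) (hv0 : ∀ m, m ∉ K → v m = 0) :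
    ∃ a b : ℤ → ℝ, (∀ m, |a m| ≤ 2) ∧ (∀ m, |b m| ≤ 1) ∧
      (∀ k ∈ K, conv a G k + conv b H k = v k) ∧
      (∀ k, |conv a G k + conv b H k| ≤ 1) ∧
      ∀ k : ℤ, (∀ m ∈ K, s * ε < |(k : ℝ) - m|) → |conv a G k + conv b H k| ≤ 1 - τ / 2 := by
  have hν0 : 0 < ν := by linarith
  set t := tailConst / ν ^ 2 with ht_def
  have ht : 0 ≤ t := div_nonneg tailConst_nonneg (by positivity)
  have hM0 : 0 ≤ M := by linarith
  have hMt : M * t ≤ q := by rw [← hq]; nlinarith [mul_nonneg hM0 ht]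
  have htq : t ≤ q := by nlinarith [mul_nonneg hM0 ht]
  have hMt0 : 0 ≤ M * t := mul_nonneg hM0 ht
  have hq0 : 0 ≤ q := hMt0.trans hMt
  have hv1 : ∀ m, |v m| ≤ 1 := fun m => by
    by_cases h : m ∈ K
    · exact (hv m h).le
    · rw [hv0 m h, abs_zero]; exact zero_le_one
  obtain ⟨a, b, ha0, hb0, ha, hb, hav, hint⟩ := exists_interpolation hs hν0 hK hM0 hG hG₁ hH hH₁
    hG0 hG₁0 hH0 hH₁0 (by linarith) hv1 hv0
  have hMMt : M * (M * t) = q := by rw [← hq]; ring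
  have hHsmall : ∀ k, |conv b H k| ≤ 8 * q := by
    intro k
    refine (abs_conv_le_of_forall_abs_le hs hν0 hK hM0 hH hM0 (fun k => (hH k).trans
      (mul_le_of_le_one_right hM0 (decay_le_one s k))) hb hb0 k).trans ?_
    nlinarith
  have hfarQ : ∀ k : ℤ, (∀ m ∈ K, s * ε < |(k : ℝ) - m|) →
      |conv a G k + conv b H k| ≤ 1 - τ / 2 := by
    intro k hk
    have hQ := abs_add_le (conv a G k) (conv b H k)
    have hHk := hHsmall k
    by_cases h : ∃ m ∈ K, |(k : ℝ) - m| < ν * s / 2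
    · obtain ⟨m, hm, hkm⟩ := h
      have h1 := abs_conv_sub_near_le hs hν0 hK hM0 hG ha ha0 hm hkm
      have h2 := abs_sub_abs_le_abs_sub (conv a G k) (a m * G (k - m))
      have h3 : |a m| ≤ 1 + 4 * q := by
        have := abs_sub_abs_le_abs_sub (a m) (v m)
        linarith [hav m, hv m hm]
      have h4 : |G (k - m)| ≤ 1 - τ := by
        rw [abs_le]
        refine ⟨by linarith [hlow (k - m)], hfar _ ?_⟩
        push_cast
        rw [abs_div, abs_of_pos hs, lt_div_iff₀ hs, mul_comm]
        exact hk m hm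
      have h5 : |a m * G (k - m)| ≤ (1 + 4 * q) * (1 - τ) := by
        rw [abs_mul]
        exact mul_le_mul h3 h4 (abs_nonneg _) (by linarith)
      nlinarith
    · push Not at h
      have h1 := abs_conv_le_of_away hs hν0 hK hM0 hG ha ha0 h
      linarith
  refine ⟨a, b, ha, fun m => (hb m).trans (by linarith), fun k hk => (hint k hk).1, fun k => ?_,
    hfarQ⟩
  by_cases hk : ∀ m ∈ K, s * ε < |(k : ℝ) - m|
  · linarith [hfarQ k hk]
  push Not at hk
  obtain ⟨m, hm, hkm⟩ := hk
  set κ := k - m with hκ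
  set h := (κ : ℝ) / s with hh_def
  have hh : |h| ≤ ε := by
    rw [hh_def, hκ, abs_div, abs_of_pos hs, div_le_iff₀ hs, mul_comm]; push_cast; exact hkm
  have hmm : |(m : ℝ) - m| < ν * s / 2 := by rw [sub_self, abs_zero]; positivity
  have hk' : m + κ = k := by rw [hκ]; ring
  have e1 := conv_taylor (summable_of_decay hs hG) (summable_of_decay hs hG₁) ha m κ h
  have e2 := conv_taylor (summable_of_decay hs hH) (summable_of_decay hs hH₁) hb m κ h
  rw [hk'] at e1 e2
  have hTM : 0 ≤ M * h ^ 2 := by positivity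
  have b1 := abs_conv_sub_near_le hs hν0 hK hTM (fun n => hGT n κ hh) ha ha0 hm hmm
  have b2 := abs_conv_le_of_forall_abs_le hs hν0 hK hTM (fun n => hHT n κ hh) hTM
    (fun n => (hHT n κ hh).trans (mul_le_of_le_one_right hTM (decay_le_one s n))) hb hb0 m
  rw [e1] at b1
  rw [e2] at b2
  simp only [sub_self, zero_add, hG0, hG₁0, mul_zero, sub_zero] at b1
  obtain ⟨i1, i2⟩ := hint m hm
  have hh2 : 0 ≤ h ^ 2 := sq_nonneg h
  have hE : |conv a G k + conv b H k - (v m + a m * (G κ - 1))| ≤ 10 * q * h ^ 2 := by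
    have : conv a G k + conv b H k - (v m + a m * (G κ - 1)) =
        (conv a G k - conv a G m - h * conv a G₁ m - a m * (G κ - 1)) +
        (conv b H k - conv b H m - h * conv b H₁ m) := by
      rw [← i1]; linear_combination h * i2
    rw [this]
    refine (abs_add_le _ _).trans ((add_le_add b1 b2).trans ?_)
    have e : M * h ^ 2 * t * 2 + (M * h ^ 2 + M * h ^ 2 * t) * (4 * (M * t)) =
        h ^ 2 * (2 * (M * t) + 4 * (M * (M * t)) + 4 * (M * (M * t)) * t) := by ring
    rw [e, hMMt]
    have hqt : q * t ≤ q * (1 / 28) := mul_le_mul_of_nonneg_left (by linarith) hq0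
    have : 2 * (M * t) + 4 * q + 4 * q * t ≤ 10 * q := by linarith
    exact (mul_le_mul_of_nonneg_left this hh2).trans_eq (mul_comm _ _)
  have hGle := hcurv κ hh
  have hGlow := hlow κ
  have hh2' : h ^ 2 ≤ ε ^ 2 := sq_le_sq' (abs_le.1 hh).1 (abs_le.1 hh).2
  have hav' : |a m - v m| ≤ 4 * q := (hav m).trans (by linarith)
  rcases eq_or_eq_neg_of_abs_eq (hv m hm) with hvm | hvm <;> rw [hvm] at hav' hE
  · refine abs_le_one_of_near_one (a := a m) (u := 1 - G κ) ?_ hav' (by linarith) hGle hh2' hq0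
      (by linarith) hτ.le hqc hqε
    convert hE using 3; ring
  · rw [← abs_neg]
    refine abs_le_one_of_near_one (a := -a m) (u := 1 - G κ) ?_ ?_ (by linarith) hGle hh2' hq0
      (by linarith) hτ.le hqc hqε
    · rw [← abs_neg]; convert hE using 2; ring
    · rw [← abs_neg]; convert hav' using 2; ring

/-- The samples of `f` on the grid of mesh `1 / s`. -/
noncomputable def samples (f : ℝ → ℝ) (s : ℝ) (k : ℤ) : ℝ := f ((k : ℝ) / s)

theorem abs_samples_le {f : ℝ → ℝ} {C : ℝ} (hf : ∀ t, |f t| ≤ C / (1 + t ^ 2)) (s : ℝ) (k : ℤ) :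
    |samples f s k| ≤ C * decay s k :=
  (hf _).trans_eq (by unfold decay; ring)

theorem samples_neg {f : ℝ → ℝ} (hf : ∀ t, f (-t) = f t) (s : ℝ) (k : ℤ) :
    samples f s (-k) = samples f s k := by
  unfold samples; push_cast; rw [neg_div, hf]

theorem samples_add (f : ℝ → ℝ) (s : ℝ) (k κ : ℤ) :
    samples f s (k + κ) = f ((k : ℝ) / s + (κ : ℝ) / s) := by
  unfold samples; push_cast; rw [add_div]

theorem abs_conv_le_of_decay {s A B : ℝ} {u v : ℤ → ℝ} (hs : 0 < s)
    (hu : ∀ k, |u k| ≤ A * decay s k) (hv : ∀ k, |v k| ≤ B * decay s k) (k : ℤ) :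
    |conv u v k| ≤ A * B * (4 * (1 + Real.pi * s)) * decay s k := by
  have hA : 0 ≤ A := by have := (abs_nonneg _).trans (hu 0); rwa [decay_zero, mul_one] at this
  have hB : 0 ≤ B := by have := (abs_nonneg _).trans (hv 0); rwa [decay_zero, mul_one] at this
  refine (abs_tsum_le_tsum ((summable_decay_mul_decay hs k).mul_left (A * B)) fun j => ?_).trans ?_
  · rw [abs_mul]
    refine (mul_le_mul (hu j) (hv _) (abs_nonneg _)
      (mul_nonneg hA (decay_nonneg _ _))).trans_eq (by ring)
  · rw [tsum_mul_left, mul_assoc (A * B)]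
    exact mul_le_mul_of_nonneg_left (tsum_decay_mul_decay_le hs k) (mul_nonneg hA hB)

theorem abs_conv_le_mul_tsum {a u : ℤ → ℝ} {C : ℝ} (ha : ∀ k, |a k| ≤ C) (hu : Summable u)
    (k : ℤ) : |conv a u k| ≤ C * ∑' j, |u j| := by
  rw [conv_comm]
  refine (abs_tsum_le_tsum (hu.abs.mul_right C) fun j => ?_).trans ?_
  · rw [abs_mul]; exact mul_le_mul_of_nonneg_left (ha _) (abs_nonneg _)
  · rw [tsum_mul_right, mul_comm]

theorem tsum_abs_le_of_decay {s A : ℝ} {u : ℤ → ℝ} (hs : 0 < s) (hA : 0 ≤ A)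
    (hu : ∀ k, |u k| ≤ A * decay s k) : ∑' k, |u k| ≤ A * (1 + Real.pi * s) := by
  refine ((summable_of_decay hs hu).abs.tsum_le_tsum hu ((summable_decay hs).mul_left A)).trans ?_
  rw [tsum_mul_left]
  exact mul_le_mul_of_nonneg_left (tsum_decay_le hs) hA

theorem conv_add_right {u p q : ℤ → ℝ} {B B' : ℝ} (hu : Summable u) (hp : ∀ k, |p k| ≤ B)
    (hq : ∀ k, |q k| ≤ B') (k : ℤ) :
    conv u (fun j => p j + q j) k = conv u p k + conv u q k := by
  unfold conv
  rw [← (summable_mul_of_bdd hu fun j => hp (k - j)).tsum_add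
    (summable_mul_of_bdd hu fun j => hq (k - j))]
  exact tsum_congr fun j => by ring

theorem conv_smul_right (u v : ℤ → ℝ) (r : ℝ) (k : ℤ) :
    conv u (fun j => r * v j) k = r * conv u v k := by
  unfold conv
  rw [← tsum_mul_left]
  exact tsum_congr fun j => by ring

theorem conv_conv_comm {w p a : ℤ → ℝ} {C : ℝ} (hw : Summable w) (hp : Summable p)
    (ha : ∀ k, |a k| ≤ C) : conv w (conv a p) = conv a (conv w p) := by
  rw [conv_comm a p, conv_assoc hw hp ha, conv_comm]

theorem tsum_mul_translate {w : ℤ → ℝ} (heven : ∀ k, w (-k) = w k) (k l : ℤ) :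
    ∑' j, w (j + k) * w (j + l) = conv w w (l - k) := by
  rw [conv, ← ((Equiv.neg ℤ).trans (Equiv.subRight k)).tsum_eq]
  refine tsum_congr fun j => ?_
  simp only [Equiv.trans_apply, Equiv.neg_apply, Equiv.subRight_apply]
  rw [← heven j]
  congr 2 <;> ring

theorem summable_mul_translate {w : ℤ → ℝ} (hw : Summable w)
    (k l : ℤ) : Summable fun j => w (j + k) * w (j + l) := by
  obtain ⟨B, hB⟩ := exists_bound_of_summable hw
  exact summable_mul_of_bdd ((Equiv.addRight k).summable_iff.2 hw) fun j => hB (j + l)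

theorem hasSum_sq_sub_translate {w : ℤ → ℝ} (hw : Summable w)
    (heven : ∀ k, w (-k) = w k) (k l : ℤ) :
    HasSum (fun j => (w (j + k) - w (j + l)) ^ 2) (2 * (conv w w 0 - conv w w (l - k))) := by
  have h := fun k l => (tsum_mul_translate heven k l) ▸ (summable_mul_translate hw k l).hasSum
  have := ((h k k).add (h l l)).sub ((h k l).mul_left 2)
  rw [sub_self, sub_self] at this
  have hf : (fun j => (w (j + k) - w (j + l)) ^ 2) = fun j =>
      w (j + k) * w (j + k) + w (j + l) * w (j + l) - 2 * (w (j + k) * w (j + l)) := by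
    funext j; ring
  have hS : 2 * (conv w w 0 - conv w w (l - k)) =
      conv w w 0 + conv w w 0 - 2 * conv w w (l - k) := by ring
  rw [hf, hS]
  exact this

theorem hasSum_sq_add_translate {w : ℤ → ℝ} (hw : Summable w)
    (heven : ∀ k, w (-k) = w k) (k l : ℤ) :
    HasSum (fun j => (w (j + k) + w (j + l)) ^ 2) (2 * (conv w w 0 + conv w w (l - k))) := by
  have h := fun k l => (tsum_mul_translate heven k l) ▸ (summable_mul_translate hw k l).hasSum
  have := ((h k k).add (h l l)).add ((h k l).mul_left 2)
  rw [sub_self, sub_self] at this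
  have hf : (fun j => (w (j + k) + w (j + l)) ^ 2) = fun j =>
      w (j + k) * w (j + k) + w (j + l) * w (j + l) + 2 * (w (j + k) * w (j + l)) := by
    funext j; ring
  have hS : 2 * (conv w w 0 + conv w w (l - k)) =
      conv w w 0 + conv w w 0 + 2 * conv w w (l - k) := by ring
  rw [hf, hS]
  exact this

theorem conv_self_sub_two_mul_le {w : ℤ → ℝ} (hw : Summable w)
    (heven : ∀ k, w (-k) = w k) (k : ℤ) :
    conv w w 0 - conv w w (2 * k) ≤ 4 * (conv w w 0 + conv w w k) := by
  have h1 := hasSum_sq_sub_translate hw heven 0 (2 * k)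
  have h2 := hasSum_sq_add_translate hw heven 0 k
  have h3 := hasSum_sq_add_translate hw heven k (2 * k)
  have h := hasSum_le (fun j => ?_) h1 ((h2.mul_left 2).add (h3.mul_left 2))
  · rw [sub_zero, sub_zero, show 2 * k - k = k by ring] at h
    linarith
  · nlinarith [sq_nonneg (w (j + 0) + 2 * w (j + k) + w (j + 2 * k))]

/-- Lower bound for Riemann sums of non-negative functions. -/
theorem le_of_hasSum_of_le_on {f : ℤ → ℝ} {s ε p S : ℝ} (hε : 0 < ε) (hs : 8 / ε ≤ s)
    (hp : 0 ≤ p) (hf0 : ∀ j, 0 ≤ f j)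
    (hf : ∀ j : ℤ, ε / 4 ≤ (j : ℝ) / s → (j : ℝ) / s ≤ ε / 2 → p ≤ f j) (hS : HasSum f S) :
    s * (ε / 8) * p ≤ S := by
  have hs0 : 0 < s := lt_of_lt_of_le (by positivity) hs
  have hsε : 8 ≤ s * ε := by rwa [div_le_iff₀ hε] at hs
  set J := Finset.Icc ⌈s * ε / 4⌉ ⌊s * ε / 2⌋
  have hcard : s * (ε / 8) ≤ (J.card : ℝ) := by
    have h1 : ((⌊s * ε / 2⌋ + 1 - ⌈s * ε / 4⌉ : ℤ) : ℝ) ≤ J.card := by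
      rw [Int.card_Icc]; exact_mod_cast Int.self_le_toNat _
    push_cast at h1
    have h2 := Int.lt_floor_add_one (s * ε / 2)
    have h3 := Int.ceil_lt_add_one (s * ε / 4)
    linarith
  refine (mul_le_mul_of_nonneg_right hcard hp).trans ?_
  rw [← nsmul_eq_mul]
  refine (Finset.card_nsmul_le_sum J f p fun j hj => ?_).trans
    (sum_le_hasSum J (fun j _ => hf0 j) hS)
  rw [Finset.mem_Icc, Int.ceil_le, Int.le_floor] at hj
  refine hf j ?_ ?_
  · rw [le_div_iff₀ hs0]; linarith [hj.1]
  · rw [div_le_iff₀ hs0]; linarith [hj.2]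

theorem Bump.summable_samples {g g₁ g₂ : ℝ → ℝ} {ε β C : ℝ} (hb : Bump g g₁ g₂ ε β C)
    {s : ℝ} (hs : 0 < s) : Summable (samples g s) :=
  summable_of_decay hs (abs_samples_le hb.abs_le s)

theorem Bump.eps_le {g g₁ g₂ : ℝ → ℝ} {ε β C : ℝ} (hb : Bump g g₁ g₂ ε β C)
    {t : ℝ} (ht : |t| ≤ ε) : g ε ≤ g t := by
  have h := hb.le_drop |t| ε (abs_nonneg t) ht ht
  rw [min_self, hb.apply_abs] at h
  have h2 : |t| ^ 2 ≤ ε ^ 2 := pow_le_pow_left₀ (abs_nonneg t) ht 2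
  nlinarith [hb.beta_pos]

theorem Bump.eps_value_pos {g g₁ g₂ : ℝ → ℝ} {ε β C : ℝ} (hb : Bump g g₁ g₂ ε β C) :
    0 < g ε := hb.pos ε (abs_of_pos hb.eps_pos).le

theorem Bump.scale_pos {g g₁ g₂ : ℝ → ℝ} {ε β C : ℝ} (hb : Bump g g₁ g₂ ε β C)
    {s : ℝ} (hs : 8 / ε ≤ s) : 0 < s := lt_of_lt_of_le (div_pos (by norm_num) hb.eps_pos) hs

theorem Bump.le_autocorr_sub {g g₁ g₂ : ℝ → ℝ} {ε β C : ℝ} (hb : Bump g g₁ g₂ ε β C)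
    {s : ℝ} (hs : 8 / ε ≤ s) (k : ℤ) :
    s * (ε / 16) * (β * ε / 4 * min |(k : ℝ) / s| (ε / 2)) ^ 2 ≤
      conv (samples g s) (samples g s) 0 - conv (samples g s) (samples g s) k := by
  have hs0 := hb.scale_pos hs
  have hε := hb.eps_pos
  have hβ := hb.beta_pos
  have heven := samples_neg hb.even s
  have hw := hb.summable_samples hs0
  have key : ∀ k : ℤ, 0 ≤ k →
      s * (ε / 16) * (β * ε / 4 * min |(k : ℝ) / s| (ε / 2)) ^ 2 ≤
      conv (samples g s) (samples g s) 0 - conv (samples g s) (samples g s) k := by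
    intro k hk
    have hk0 : (0 : ℝ) ≤ (k : ℝ) / s := div_nonneg (by exact_mod_cast hk) hs0.le
    rw [abs_of_nonneg hk0]
    have h := le_of_hasSum_of_le_on hε hs (sq_nonneg (β * ε / 4 * min ((k : ℝ) / s) (ε / 2)))
      (fun j => sq_nonneg _) (fun j h1 h2 => ?_) (hasSum_sq_sub_translate hw heven 0 k)
    · rw [sub_zero] at h; linarith
    · have := hb.le_drop_mid h1 h2 hk0
      rw [add_zero, samples_add]
      exact pow_le_pow_left₀ (mul_nonneg (by positivity) (le_min hk0 (by linarith))) this 2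
  rcases le_total 0 k with hk | hk
  · exact key k hk
  · have h := key (-k) (by omega)
    have h2 : conv (samples g s) (samples g s) (-k) = conv (samples g s) (samples g s) k := by
      have h1 := tsum_mul_translate heven 0 k
      have h2 := tsum_mul_translate heven k 0
      rw [sub_zero] at h1
      rw [zero_sub] at h2
      rw [← h1, ← h2]
      exact tsum_congr fun j => mul_comm _ _
    rwa [h2, Int.cast_neg, neg_div, abs_neg] at h

theorem Bump.le_autocorr_zero {g g₁ g₂ : ℝ → ℝ} {ε β C : ℝ} (hb : Bump g g₁ g₂ ε β C)
    {s : ℝ} (hs : 8 / ε ≤ s) :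
    s * (ε / 8) * g ε ^ 2 ≤ conv (samples g s) (samples g s) 0 := by
  have hs0 := hb.scale_pos hs
  have hε := hb.eps_pos
  have heven := samples_neg hb.even s
  have hw := hb.summable_samples hs0
  have h := le_of_hasSum_of_le_on hε hs (sq_nonneg (g ε))
    (fun j => mul_self_nonneg _) (fun j h1 h2 => ?_) (summable_mul_translate hw 0 0).hasSum
  · rwa [tsum_mul_translate heven, sub_zero] at h
  · rw [add_zero, ← sq]
    refine pow_le_pow_left₀ hb.eps_value_pos.le (hb.eps_le ?_) 2
    rw [abs_of_nonneg (by linarith)]; linarith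

theorem Bump.le_autocorr_add {g g₁ g₂ : ℝ → ℝ} {ε β C : ℝ} (hb : Bump g g₁ g₂ ε β C)
    {s : ℝ} (hs : 8 / ε ≤ s) (k : ℤ) :
    s * min (ε / 16 * g ε ^ 2) (ε / 256 * (β * ε / 4) ^ 2 * ε ^ 2) ≤
      conv (samples g s) (samples g s) 0 + conv (samples g s) (samples g s) k := by
  have hs0 := hb.scale_pos hs
  have hε := hb.eps_pos
  have heven := samples_neg hb.even s
  have hw := hb.summable_samples hs0
  rcases le_or_gt |(k : ℝ) / s| (ε / 4) with hk | hk
  · refine (mul_le_mul_of_nonneg_left (min_le_left _ _) hs0.le).trans ?_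
    have h := le_of_hasSum_of_le_on hε hs (sq_nonneg (g ε))
      (fun j => sq_nonneg _) (fun j h1 h2 => ?_) (hasSum_sq_add_translate hw heven 0 k)
    · rw [sub_zero] at h; linarith
    · have h3 : g ε ≤ samples g s (j + 0) := by
        rw [add_zero]
        refine hb.eps_le ?_
        rw [abs_of_nonneg (by linarith)]; linarith
      have h4 : 0 < samples g s (j + k) := by
        rw [samples_add]
        refine hb.pos _ ?_
        rw [_root_.abs_le] at hk ⊢
        constructor <;> linarith
      exact pow_le_pow_left₀ hb.eps_value_pos.le (by linarith) 2
  · refine (mul_le_mul_of_nonneg_left (min_le_right _ _) hs0.le).trans ?_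
    have h1 := conv_self_sub_two_mul_le hw heven k
    have h2 := hb.le_autocorr_sub hs (2 * k)
    rw [min_eq_right] at h2
    · nlinarith
    · push_cast
      rw [mul_div_assoc, abs_mul, abs_two]; linarith

theorem exists_forall_div_sq_le (A : ℝ) {q : ℝ} (hq : 0 < q) (m : ℝ) :
    ∃ ν₀ > m, 0 < ν₀ ∧ ∀ ν ≥ ν₀, A / ν ^ 2 ≤ q := by
  refine ⟨max (m + 1) (max 1 (A / q)), lt_of_lt_of_le (lt_add_one m) (le_max_left _ _),
    lt_of_lt_of_le one_pos ((le_max_left _ _).trans (le_max_right _ _)), fun ν hν => ?_⟩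
  have h1 : 1 ≤ ν := ((le_max_left _ _).trans (le_max_right _ _)).trans hν
  have h2 : A / q ≤ ν := ((le_max_right _ _).trans (le_max_right _ _)).trans hν
  rw [div_le_iff₀ hq] at h2
  rw [div_le_iff₀ (by positivity)]
  have h3 : q * ν * 1 ≤ q * ν * ν := mul_le_mul_of_nonneg_left h1 (by positivity)
  linarith

theorem one_add_pi_mul_le {s : ℝ} (hs : 1 ≤ s) : 1 + Real.pi * s ≤ 5 * s := by
  nlinarith [Real.pi_lt_four]

/-- The odd combination of two point masses at distance `r` from the origin. -/
noncomputable def dipole (r : ℤ) (D : ℝ) (j : ℤ) : ℝ :=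
  (if j = -r then 1 / D else 0) - if j = r then 1 / D else 0

theorem hasSum_dipole_mul (r : ℤ) (D : ℝ) (u : ℤ → ℝ) :
    HasSum (fun j => dipole r D j * u j) ((u (-r) - u r) / D) := by
  have h1 := hasSum_ite_eq (-r) (1 / D * u (-r))
  have h2 := hasSum_ite_eq r (1 / D * u r)
  have hf : (fun j => dipole r D j * u j) = fun j =>
      (if j = -r then 1 / D * u (-r) else 0) - if j = r then 1 / D * u r else 0 := by
    funext j
    unfold dipole
    rw [sub_mul, ite_mul, ite_mul, zero_mul]
    congr 1
    · split_ifs with h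
      · rw [h]
      · rfl
    · split_ifs with h
      · rw [h]
      · rfl
  have hS : (u (-r) - u r) / D = 1 / D * u (-r) - 1 / D * u r := by ring
  rw [hf, hS]
  exact h1.sub h2

theorem summable_dipole (r : ℤ) (D : ℝ) : Summable (dipole r D) := by
  simpa using (hasSum_dipole_mul r D fun _ => 1).summable

theorem conv_dipole (u : ℤ → ℝ) (r : ℤ) (D : ℝ) (k : ℤ) :
    conv u (dipole r D) k = (u (k + r) - u (k - r)) / D := by
  rw [conv_comm, conv, (hasSum_dipole_mul r D fun j => u (k - j)).tsum_eq, sub_neg_eq_add]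

theorem abs_conv_dipole_le {b : ℤ → ℝ} {B : ℝ} (hB : ∀ k, |b k| ≤ B) (r : ℤ) {D p : ℝ}
    (hp : 0 < p) (hD : p ≤ |D|) (k : ℤ) : |conv b (dipole r D) k| ≤ 2 * B / p := by
  rw [conv_dipole, abs_div]
  refine div_le_div₀ (by linarith [(abs_nonneg _).trans (hB 0)]) ?_ hp hD
  exact (abs_sub _ _).trans (by linarith [hB (k + r), hB (k - r)])

theorem Bump.abs_samples_taylor_le {g g₁ g₂ : ℝ → ℝ} {ε β C : ℝ} (hb : Bump g g₁ g₂ ε β C)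
    {s : ℝ} (n κ : ℤ) (h : |(κ : ℝ) / s| ≤ ε) :
    |samples g s (n + κ) - samples g s n - (κ : ℝ) / s * samples g₁ s n| ≤
      (2 + 2 * ε ^ 2) * C * ((κ : ℝ) / s) ^ 2 * decay s n := by
  rw [samples_add]
  exact (abs_sub_taylor_le hb.hasDerivAt hb.hasDerivAt₁ hb.abs_le₂ h).trans_eq
    (by unfold decay; ring)

/-- Difference quotient bounds for the odd interpolation kernel. -/
theorem abs_dipole_quotient_le {s ε A p D : ℝ} {u : ℤ → ℝ} (hu : ∀ k, |u k| ≤ A * decay s k)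
    {r : ℤ} (hr : |(r : ℝ) / s| ≤ ε) (hp : 0 < p) (hD : p ≤ |D|) (k : ℤ) :
    |conv u (dipole r D) k| ≤ 2 * A * (2 + 2 * ε ^ 2) / p * decay s k := by
  have hA : 0 ≤ A := by have := (abs_nonneg _).trans (hu 0); rwa [decay_zero, mul_one] at this
  have h1 := (hu (k + r)).trans (mul_le_mul_of_nonneg_left (decay_add_le k r hr) hA)
  have h2 := (hu (k + -r)).trans (mul_le_mul_of_nonneg_left
    (decay_add_le (ε := ε) k (-r) (by rwa [Int.cast_neg, neg_div, abs_neg])) hA)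
  rw [conv_dipole, abs_div, sub_eq_add_neg k r]
  have hd := decay_nonneg s k
  refine (div_le_div₀ (c := 2 * A * (2 + 2 * ε ^ 2) * decay s k) (by positivity) ?_ hp hD).trans_eq
    (by ring)
  exact (abs_sub _ _).trans (by linarith)

theorem conv_taylor_left {u u₁ b : ℤ → ℝ} {B : ℝ} (hu : Summable u) (hu₁ : Summable u₁)
    (hb : ∀ m, |b m| ≤ B) (m κ : ℤ) (h : ℝ) :
    conv (fun n => u (n + κ) - u n - h * u₁ n) b m =
      conv u b (m + κ) - conv u b m - h * conv u₁ b m := by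
  rw [conv_comm, conv_comm u, conv_comm u₁, conv_taylor hu hu₁ hb]

/-- Uniform dual certificates at coarse scales. -/
theorem Bump.exists_certificate_of_large {g g₁ g₂ : ℝ → ℝ} {ε β C : ℝ}
    (hb : Bump g g₁ g₂ ε β C) :
    ∃ B τ ν₀ : ℝ, 0 < τ ∧ 0 < ν₀ ∧ ∀ s : ℝ, 1 ≤ s → 8 / ε ≤ s → ∀ ν ≥ ν₀, ∀ K : Set ℤ,
      Separated K (ν * s) → ∀ v : ℤ → ℝ, (∀ m ∈ K, |v m| = 1) → (∀ m, m ∉ K → v m = 0) →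
      ∃ c : ℤ → ℝ, (∀ k, |c k| ≤ B) ∧ (∀ k ∈ K, conv (samples g s) c k = v k) ∧
        (∀ k, |conv (samples g s) c k| ≤ 1) ∧
        ∀ k : ℤ, (∀ m ∈ K, s * ε < |(k : ℝ) - m|) → |conv (samples g s) c k| ≤ 1 - τ := by
  have hε := hb.eps_pos
  have hβ := hb.beta_pos
  have hC := hb.const_pos
  have hgε := hb.eps_value_pos
  set a₀ := ε / 8 * g ε ^ 2 with ha₀_def
  set A := 20 * C ^ 2 with hA_def
  set E := 2 + 2 * ε ^ 2 with hE_def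
  set c₀ := ε / 16 * (β * ε / 4) ^ 2 with hc₀_def
  set τ₀ := min (ε / 16 * g ε ^ 2) (ε / 256 * (β * ε / 4) ^ 2 * ε ^ 2) with hτ₀_def
  set c := c₀ / 4 / A with hc_def
  set τ := min 1 (τ₀ / A) with hτ_def
  set p := β * ε with hp_def
  set M := max 1 (max (A / a₀) (max (E * A / a₀) (max (2 * C * E / p) (2 * (E * C) * E / p))))
    with hM_def
  have hE : 0 < E := by positivity
  have hA : 0 < A := by positivity
  have ha₀ : 0 < a₀ := by positivity
  have hc₀ : 0 < c₀ := by positivity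
  have hτ₀ : 0 < τ₀ := lt_min (by positivity) (by positivity)
  have hc : 0 < c := by positivity
  have hτ : 0 < τ := lt_min one_pos (by positivity)
  have hp : 0 < p := by positivity
  have hM1 : 1 ≤ M := le_max_left _ _
  have hM2 : A / a₀ ≤ M := (le_max_left _ _).trans (le_max_right _ _)
  have hM3 : E * A / a₀ ≤ M :=
    ((le_max_left _ _).trans (le_max_right _ _)).trans (le_max_right _ _)
  have hM4 : 2 * C * E / p ≤ M := (((le_max_left _ _).trans (le_max_right _ _)).trans
    (le_max_right _ _)).trans (le_max_right _ _)
  have hM5 : 2 * (E * C) * E / p ≤ M := (((le_max_right _ _).trans (le_max_right _ _)).trans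
    (le_max_right _ _)).trans (le_max_right _ _)
  obtain ⟨ν₀, hν₀, hν₀pos, hsmall⟩ := exists_forall_div_sq_le (M ^ 2 * tailConst)
    (q := min (c / 20) (min (τ / 28) (τ / (8 + 10 * ε ^ 2))))
    (lt_min (by positivity) (lt_min (by positivity) (by positivity))) (2 * ε)
  refine ⟨2 * (5 * C / a₀) + 2 * 1 / p, τ / 2, ν₀, by positivity, hν₀pos,
    fun s hs1 hs ν hν K hK v hv hv0 => ?_⟩
  have hs0 : 0 < s := by linarith
  have hq := hsmall ν hν
  rw [mul_div_assoc, le_min_iff, le_min_iff] at hq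
  obtain ⟨hq1, hq2, hq3⟩ := hq
  have hwn := samples_neg hb.even s
  have hws := hb.summable_samples hs0
  have hw := abs_samples_le hb.abs_le s
  have hw₁ := abs_samples_le hb.abs_le₁ s
  have hw₁s := summable_of_decay hs0 hw₁
  obtain ⟨W, hW⟩ := exists_bound_of_summable hws
  set w := samples g s
  set w₁ := samples g₁ s
  set Γ := conv w w 0 with hΓ_def
  have hsπ : 4 * (1 + Real.pi * s) ≤ 20 * s := by linarith [one_add_pi_mul_le hs1]
  have hΓlow : s * a₀ ≤ Γ := by
    have := hb.le_autocorr_zero hs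
    rw [mul_assoc] at this
    exact this
  have hΓpos : 0 < Γ := lt_of_lt_of_le (by positivity) hΓlow
  have hAs : ∀ {B : ℝ}, 0 ≤ B → ∀ k, B * (4 * (1 + Real.pi * s)) * decay s k ≤
      B * (20 * s) * decay s k := fun hB k => by gcongr; exact decay_nonneg s k
  have hdivΓ : ∀ {B : ℝ}, 0 ≤ B → ∀ {x : ℝ} {k : ℤ}, |x| ≤ B * (20 * s) * decay s k →
      |Γ⁻¹ * x| ≤ B * 20 / a₀ * decay s k := by
    intro B hB x k hx
    rw [abs_mul, abs_of_pos (inv_pos.2 hΓpos), inv_mul_eq_div, div_le_iff₀ hΓpos]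
    have : B * 20 / a₀ * decay s k * (s * a₀) ≤ B * 20 / a₀ * decay s k * Γ :=
      mul_le_mul_of_nonneg_left hΓlow
        (mul_nonneg (by positivity) (decay_nonneg s k))
    refine hx.trans (le_trans (le_of_eq ?_) this)
    field_simp
  have hΓup : Γ ≤ s * A := by
    have h1 := (abs_conv_le_of_decay hs0 hw hw 0).trans (hAs (by positivity) 0)
    rw [decay_zero, mul_one] at h1
    exact (le_abs_self _).trans (h1.trans_eq (by rw [hA_def]; ring))
  have hG : ∀ k, |Γ⁻¹ * conv w w k| ≤ M * decay s k := fun k =>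
    (hdivΓ (by positivity) ((abs_conv_le_of_decay hs0 hw hw k).trans
      (hAs (by positivity) k))).trans (mul_le_mul_of_nonneg_right
        (le_trans (le_of_eq (by rw [hA_def]; ring)) hM2) (decay_nonneg s k))
  have hG₁ : ∀ k, |Γ⁻¹ * conv w w₁ k| ≤ M * decay s k := fun k =>
    (hdivΓ (by positivity) ((abs_conv_le_of_decay hs0 hw hw₁ k).trans
      (hAs (by positivity) k))).trans (mul_le_mul_of_nonneg_right
        (le_trans (le_of_eq (by rw [hA_def]; ring)) hM2) (decay_nonneg s k))
  have hG₁0 : conv w w₁ 0 = 0 := by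
    have h1 : conv w w₁ 0 = -conv w w₁ 0 := by
      conv_lhs => rw [conv, ← (Equiv.neg ℤ).tsum_eq]
      rw [conv, ← tsum_neg]
      refine tsum_congr fun j => ?_
      simp only [Equiv.neg_apply, hwn]
      have : w₁ (0 - -j) = -w₁ (0 - j) := by
        simp only [w₁, samples]
        rw [← hb.odd]; congr 1; push_cast; ring
      rw [this, mul_neg]
    linarith
  have hGT : ∀ k κ : ℤ, |(κ : ℝ) / s| ≤ ε →
      |Γ⁻¹ * conv w w (k + κ) - Γ⁻¹ * conv w w k - (κ : ℝ) / s * (Γ⁻¹ * conv w w₁ k)| ≤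
        M * ((κ : ℝ) / s) ^ 2 * decay s k := by
    intro k κ hκ
    have h1 := abs_conv_le_of_decay hs0 hw (fun n => hb.abs_samples_taylor_le n κ hκ) k
    rw [conv_taylor hws hw₁s hW] at h1
    have h2 := hdivΓ (by positivity) (h1.trans (hAs (by positivity) k))
    have h3 : Γ⁻¹ * conv w w (k + κ) - Γ⁻¹ * conv w w k - (κ : ℝ) / s * (Γ⁻¹ * conv w w₁ k) =
        Γ⁻¹ * (conv w w (k + κ) - conv w w k - (κ : ℝ) / s * conv w w₁ k) := by ring
    rw [h3]
    refine h2.trans (mul_le_mul_of_nonneg_right ?_ (decay_nonneg s k))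
    refine le_trans (le_of_eq ?_) (mul_le_mul_of_nonneg_right hM3 (sq_nonneg ((κ : ℝ) / s)))
    rw [hA_def, hE_def]; ring
  have hgap : ∀ {x y : ℝ}, 0 ≤ x → s * x ≤ y → x / A ≤ Γ⁻¹ * y := by
    intro x y hx hxy
    rw [inv_mul_eq_div, div_le_div_iff₀ hA hΓpos]
    nlinarith [mul_le_mul_of_nonneg_left hΓup hx]
  have hone : Γ⁻¹ * Γ = 1 := inv_mul_cancel₀ hΓpos.ne'
  set r := ⌊s * ε⌋
  have hsε : 8 ≤ s * ε := by rwa [div_le_iff₀ hε] at hs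
  have hr1 : ε / 2 ≤ (r : ℝ) / s := by
    rw [le_div_iff₀ hs0]; linarith [Int.lt_floor_add_one (s * ε)]
  have hr2 : (r : ℝ) / s ≤ ε := by
    rw [div_le_iff₀ hs0]; linarith [Int.floor_le (s * ε)]
  have hr : |(r : ℝ) / s| ≤ ε := by rwa [abs_of_nonneg (by linarith)]
  set D := 2 * g₁ ((r : ℝ) / s) with hD_def
  have hD : p ≤ |D| := by
    have := hb.le_slope _ (by linarith) hr2
    rw [← abs_neg]
    refine le_trans ?_ (le_abs_self _)
    have h2 : β * (ε / 2) ≤ β * ((r : ℝ) / s) := mul_le_mul_of_nonneg_left hr1 hβ.le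
    rw [hD_def, hp_def]
    linarith
  have hD0 : D ≠ 0 := abs_pos.1 (hp.trans_le hD)
  obtain ⟨B', hB'⟩ := exists_bound_of_summable (summable_dipole r D)
  have hH : ∀ k, |conv w (dipole r D) k| ≤ M * decay s k := fun k =>
    (abs_dipole_quotient_le hw hr hp hD k).trans
      (mul_le_mul_of_nonneg_right hM4 (decay_nonneg s k))
  have hH₁ : ∀ k, |conv w₁ (dipole r D) k| ≤ M * decay s k := fun k =>
    (abs_dipole_quotient_le hw₁ hr hp hD k).trans
      (mul_le_mul_of_nonneg_right hM4 (decay_nonneg s k))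
  have hH0 : conv w (dipole r D) 0 = 0 := by
    rw [conv_dipole, zero_add, zero_sub, hwn, sub_self, zero_div]
  have hH₁0 : conv w₁ (dipole r D) 0 = 1 := by
    rw [conv_dipole, zero_add, zero_sub]
    have : w₁ (-r) = -w₁ r := by
      simp only [w₁, samples]; push_cast; rw [neg_div, hb.odd]
    rw [this, sub_neg_eq_add, ← two_mul]
    exact div_self hD0
  have hHT : ∀ k κ : ℤ, |(κ : ℝ) / s| ≤ ε →
      |conv w (dipole r D) (k + κ) - conv w (dipole r D) k -
        (κ : ℝ) / s * conv w₁ (dipole r D) k| ≤ M * ((κ : ℝ) / s) ^ 2 * decay s k := by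
    intro k κ hκ
    rw [← conv_taylor_left hws hw₁s hB']
    refine (abs_dipole_quotient_le (fun n => hb.abs_samples_taylor_le n κ hκ) hr hp hD k).trans
      (mul_le_mul_of_nonneg_right ?_ (decay_nonneg s k))
    refine le_trans (le_of_eq ?_) (mul_le_mul_of_nonneg_right hM5 (sq_nonneg ((κ : ℝ) / s)))
    rw [hE_def]; ring
  have hcurv : ∀ κ : ℤ, |(κ : ℝ) / s| ≤ ε → c * ((κ : ℝ) / s) ^ 2 ≤ 1 - Γ⁻¹ * conv w w κ := by
    intro κ hκ
    have h1 := hb.le_autocorr_sub hs κ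
    have h2 : |(κ : ℝ) / s| / 2 ≤ min |(κ : ℝ) / s| (ε / 2) :=
      le_min (by linarith [abs_nonneg ((κ : ℝ) / s)]) (by linarith)
    have h3 : (|(κ : ℝ) / s| / 2) ^ 2 ≤ (min |(κ : ℝ) / s| (ε / 2)) ^ 2 :=
      pow_le_pow_left₀ (by positivity) h2 2
    rw [div_pow, sq_abs] at h3
    have h4 : c₀ / 4 * ((κ : ℝ) / s) ^ 2 ≤
        ε / 16 * (β * ε / 4 * min |(κ : ℝ) / s| (ε / 2)) ^ 2 := by
      rw [mul_pow, ← mul_assoc, ← hc₀_def]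
      refine le_trans (le_of_eq ?_) (mul_le_mul_of_nonneg_left h3 hc₀.le)
      ring
    have h5 := hgap (by positivity) ((mul_le_mul_of_nonneg_left h4 hs0.le).trans
      ((mul_assoc _ _ _).symm.trans_le h1))
    rw [mul_sub, ← hΓ_def, hone] at h5
    refine le_trans (le_of_eq ?_) h5
    rw [hc_def]; ring
  have hlow : ∀ κ : ℤ, τ ≤ 1 + Γ⁻¹ * conv w w κ := by
    intro κ
    have h5 := hgap hτ₀.le (hb.le_autocorr_add hs κ)
    rw [mul_add, ← hΓ_def, hone] at h5
    exact (min_le_right _ _).trans h5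
  have hfar : ∀ κ : ℤ, ε < |(κ : ℝ) / s| → Γ⁻¹ * conv w w κ ≤ 1 - τ := by
    intro κ hκ
    have h1 := hb.le_autocorr_sub hs κ
    rw [min_eq_right (by linarith), mul_assoc] at h1
    have h4 : τ₀ ≤ ε / 16 * (β * ε / 4 * (ε / 2)) ^ 2 := by
      refine (min_le_right _ _).trans ?_
      have : 0 ≤ ε * (β * ε / 4) ^ 2 * ε ^ 2 := by positivity
      linarith
    have h5 := hgap hτ₀.le ((mul_le_mul_of_nonneg_left h4 hs0.le).trans h1)
    rw [mul_sub, ← hΓ_def, hone] at h5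
    linarith [min_le_right 1 (τ₀ / A)]
  obtain ⟨a, b, ha, hb', hint, hle, hfarQ⟩ := exists_hermite_certificate (v := v)
    (G := fun k => Γ⁻¹ * conv w w k) (G₁ := fun k => Γ⁻¹ * conv w w₁ k)
    (H := conv w (dipole r D)) (H₁ := conv w₁ (dipole r D)) hs0 hε (hν₀.trans_le hν) hK hM1 hG hG₁
    hH hH₁ hone (by rw [hG₁0, mul_zero]) hH0 hH₁0 hGT hHT hτ (min_le_left _ _) hcurv hlow hfar rfl
    (by linarith) (by linarith) (by rwa [← le_div_iff₀ (by positivity)]) hv hv0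
  have hc1 : ∀ k, |conv a (fun j => Γ⁻¹ * w j) k| ≤ 2 * (5 * C / a₀) := by
    intro k
    refine (abs_conv_le_mul_tsum ha (hws.mul_left _) k).trans ?_
    refine mul_le_mul_of_nonneg_left ?_ zero_le_two
    simp_rw [abs_mul, abs_of_pos (inv_pos.2 hΓpos)]
    rw [tsum_mul_left, inv_mul_eq_div, div_le_iff₀ hΓpos]
    have h1 := (tsum_abs_le_of_decay hs0 hC.le hw).trans
      (mul_le_mul_of_nonneg_left (one_add_pi_mul_le hs1) hC.le)
    have h2 : 5 * C / a₀ * (s * a₀) ≤ 5 * C / a₀ * Γ :=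
      mul_le_mul_of_nonneg_left hΓlow (by positivity)
    refine h1.trans (le_trans (le_of_eq ?_) h2)
    field_simp
  have hc2 := abs_conv_dipole_le hb' r hp hD
  have hQ : ∀ k, conv w (fun k => conv a (fun j => Γ⁻¹ * w j) k + conv b (dipole r D) k) k =
      conv a (fun k => Γ⁻¹ * conv w w k) k + conv b (conv w (dipole r D)) k := by
    intro k
    rw [conv_add_right hws hc1 hc2, conv_conv_comm hws (hws.mul_left _) ha,
      conv_conv_comm hws (summable_dipole r D) hb', funext (conv_smul_right w w Γ⁻¹)]
  refine ⟨fun k => conv a (fun j => Γ⁻¹ * w j) k + conv b (dipole r D) k,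
    fun k => (abs_add_le _ _).trans (add_le_add (hc1 k) (hc2 k)), fun k hk => ?_, fun k => ?_,
    fun k hk => ?_⟩ <;> rw [hQ]
  exacts [hint k hk, hle k, hfarQ k hk]

/-- A polynomial close to the constant `1 - κ` on the positive part of `[-B, B]` and to zero on the
negative part. -/
theorem exists_cutoff_polynomial {B κ : ℝ} (hB : 0 < B) (hκ : 0 < κ) (hκ1 : κ < 1) :
    ∃ P : Polynomial ℝ, ∀ x, |x| ≤ B →
      |P.eval x| ≤ 1 ∧ 0 ≤ x * (P.eval x - (1 - κ)) ∧ -κ ≤ x * P.eval x := by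
  set f : ℝ → ℝ := fun x => (1 - κ) * max (-x) 0 / max (κ ^ 2) (x ^ 2)
  have hmax : ∀ x : ℝ, 0 < max (κ ^ 2) (x ^ 2) := fun x => lt_max_of_lt_left (by positivity)
  have hf : Continuous f := by
    refine Continuous.div (by fun_prop) (by fun_prop) fun x => (hmax x).ne'
  obtain ⟨W, hW⟩ := exists_polynomial_near_of_continuousOn (-B) B (fun x => f x + κ / B / 2)
    (hf.add continuous_const).continuousOn (κ / B / 2) (by positivity)
  refine ⟨Polynomial.C (1 - κ) + Polynomial.X * W, fun x hx => ?_⟩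
  have hWx := hW x (abs_le.1 hx)
  simp only [Polynomial.eval_add, Polynomial.eval_C, Polynomial.eval_mul, Polynomial.eval_X]
  set e := W.eval x - f x with he_def
  have he : 0 ≤ e ∧ e ≤ κ / B := by
    rw [abs_lt] at hWx
    constructor <;> linarith [hWx.1, hWx.2]
  have hxe : |x| * e ≤ κ := by
    calc |x| * e ≤ B * (κ / B) := mul_le_mul hx he.2 he.1 hB.le
      _ = κ := by field_simp
  have hWe : W.eval x = f x + e := by rw [he_def]; ring
  have hf0 : 0 ≤ f x :=
    div_nonneg (mul_nonneg (by linarith) (le_max_right _ _)) (hmax x).le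
  rw [hWe]
  have hsecond : 0 ≤ x * (1 - κ + x * (f x + e) - (1 - κ)) := by
    have : x * (1 - κ + x * (f x + e) - (1 - κ)) = x ^ 2 * (f x + e) := by ring
    rw [this]
    exact mul_nonneg (sq_nonneg x) (by linarith [he.1])
  rcases le_or_gt 0 x with h | h
  · have hfx : f x = 0 := by simp only [f]; rw [max_eq_right (by linarith)]; ring
    rw [abs_of_nonneg h] at hxe
    rw [hfx, zero_add] at hsecond ⊢
    have hxe0 := mul_nonneg h he.1
    refine ⟨?_, hsecond, ?_⟩
    · rw [abs_le]; constructor <;> linarith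
    · have : 0 ≤ x * (1 - κ + x * e) := mul_nonneg h (by linarith)
      linarith
  · rw [abs_of_neg h] at hxe
    have hxf : x * f x = -((1 - κ) * (x ^ 2 / max (κ ^ 2) (x ^ 2))) := by
      simp only [f]; rw [max_eq_left (by linarith)]; ring
    set ρ := x ^ 2 / max (κ ^ 2) (x ^ 2) with hρ
    have hρ0 : 0 ≤ ρ := div_nonneg (sq_nonneg x) (hmax x).le
    have hρ1 : ρ ≤ 1 := (div_le_one (hmax x)).2 (le_max_right _ _)
    have hxe0 : x * e ≤ 0 := mul_nonpos_of_nonpos_of_nonneg h.le he.1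
    have hP : 1 - κ + x * (f x + e) = (1 - κ) * (1 - ρ) + x * e := by
      rw [mul_add, hxf]; ring
    have h1 : (1 - κ) * (1 - ρ) ≤ 1 := by nlinarith
    have h2 : 0 ≤ (1 - κ) * (1 - ρ) := mul_nonneg (by linarith) (by linarith)
    have habs : |1 - κ + x * (f x + e)| ≤ 1 := by
      rw [hP, abs_le]; constructor <;> linarith
    refine ⟨habs, hsecond, ?_⟩
    rcases le_or_gt (-κ) x with hx' | hx'
    · have h3 := (abs_le.1 habs).2
      nlinarith
    · have hρ' : ρ = 1 := by
        rw [hρ, max_eq_right (by nlinarith)]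
        exact div_self (by nlinarith)
      rw [hP, hρ', sub_self, mul_zero, zero_add]
      have := mul_nonneg_of_nonpos_of_nonpos h.le hxe0
      linarith

/-- The `k`-th cosine coefficient of `φ`. -/
noncomputable def cosCoeff (φ : ℝ → ℝ) (k : ℤ) : ℝ :=
  (2 * Real.pi)⁻¹ * ∫ θ in (-Real.pi)..Real.pi, φ θ * Real.cos (k * θ)

theorem intervalIntegrable_mul_cos {φ : ℝ → ℝ} (hφ : Continuous φ) (k : ℤ) :
    IntervalIntegrable (fun θ => φ θ * Real.cos (k * θ)) MeasureTheory.volume (-Real.pi) Real.pi :=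
  Continuous.intervalIntegrable (by fun_prop) _ _

theorem cosCoeff_one (k : ℤ) : cosCoeff (fun _ => 1) k = if k = 0 then 1 else 0 := by
  unfold cosCoeff
  split_ifs with h
  · subst h
    simp only [Int.cast_zero, zero_mul, Real.cos_zero, mul_one, intervalIntegral.integral_const,
      smul_eq_mul]
    have := Real.pi_ne_zero
    field_simp
    ring
  · have hk : (k : ℝ) ≠ 0 := by exact_mod_cast h
    simp only [one_mul]
    rw [intervalIntegral.integral_comp_mul_left (fun x => Real.cos x) hk, integral_cos, mul_neg,
      Real.sin_neg, Real.sin_int_mul_pi]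
    simp

theorem abs_cosCoeff_le {φ : ℝ → ℝ} {B : ℝ} (h : ∀ θ, |φ θ| ≤ B) (k : ℤ) : |cosCoeff φ k| ≤ B := by
  have hπ := Real.pi_pos
  have h1 := intervalIntegral.norm_integral_le_of_norm_le_const (a := -Real.pi) (b := Real.pi)
    (f := fun θ => φ θ * Real.cos (k * θ)) (C := B) fun θ _ => by
      rw [norm_mul, Real.norm_eq_abs, Real.norm_eq_abs]
      exact (mul_le_of_le_one_right (abs_nonneg _) (Real.abs_cos_le_one _)).trans (h θ)
  rw [sub_neg_eq_add, ← two_mul, abs_of_pos (by positivity : 0 < 2 * Real.pi)] at h1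
  unfold cosCoeff
  rw [abs_mul, abs_of_pos (by positivity), inv_mul_le_iff₀ (by positivity), mul_comm]
  exact h1

theorem cosCoeff_add {φ ψ : ℝ → ℝ} (hφ : Continuous φ) (hψ : Continuous ψ) (k : ℤ) :
    cosCoeff (fun θ => φ θ + ψ θ) k = cosCoeff φ k + cosCoeff ψ k := by
  unfold cosCoeff
  rw [← mul_add, ← intervalIntegral.integral_add (intervalIntegrable_mul_cos hφ k)
    (intervalIntegrable_mul_cos hψ k)]
  simp_rw [add_mul]

theorem cosCoeff_const_mul (r : ℝ) (φ : ℝ → ℝ) (k : ℤ) :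
    cosCoeff (fun θ => r * φ θ) k = r * cosCoeff φ k := by
  unfold cosCoeff
  simp_rw [mul_assoc]
  rw [intervalIntegral.integral_const_mul]
  ring

theorem cosCoeff_le_zero {φ : ℝ → ℝ} (hφ : Continuous φ) (h : ∀ θ, 0 ≤ φ θ) (k : ℤ) :
    cosCoeff φ k ≤ cosCoeff φ 0 := by
  have hπ := Real.pi_pos
  unfold cosCoeff
  refine mul_le_mul_of_nonneg_left ?_ (by positivity)
  refine intervalIntegral.integral_mono_on (by linarith) (intervalIntegrable_mul_cos hφ k)
    (intervalIntegrable_mul_cos hφ 0) fun θ _ => ?_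
  rw [Int.cast_zero, zero_mul, Real.cos_zero]
  exact mul_le_mul_of_nonneg_left (Real.cos_le_one _) (h θ)

theorem cosCoeff_zero_nonneg {φ : ℝ → ℝ} (h : ∀ θ, 0 ≤ φ θ) : 0 ≤ cosCoeff φ 0 := by
  have hπ := Real.pi_pos
  unfold cosCoeff
  refine mul_nonneg (by positivity) (intervalIntegral.integral_nonneg (by linarith) fun θ _ => ?_)
  rw [Int.cast_zero, zero_mul, Real.cos_zero, mul_one]
  exact h θ

theorem le_cosCoeff_add {φ : ℝ → ℝ} {κ : ℝ} (hφ : Continuous φ) (hκ : 0 ≤ κ)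
    (h : ∀ θ, -κ ≤ φ θ) (k : ℤ) :
    (cosCoeff φ 0 - cosCoeff φ (2 * k)) / 4 - 2 * κ ≤ cosCoeff φ 0 + cosCoeff φ k := by
  have hπ := Real.pi_pos
  have hI := intervalIntegrable_mul_cos hφ
  have hnn : 0 ≤ ∫ θ in (-Real.pi)..Real.pi, (φ θ * Real.cos ((0 : ℤ) * θ) +
      φ θ * Real.cos (k * θ) - (4⁻¹ * (φ θ * Real.cos ((0 : ℤ) * θ) -
      φ θ * Real.cos ((2 * k : ℤ) * θ)) - 2 * κ)) := by
    refine intervalIntegral.integral_nonneg (by linarith) fun θ _ => ?_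
    have h2 : Real.cos ((2 * k : ℤ) * θ) = 2 * Real.cos (k * θ) ^ 2 - 1 := by
      rw [← Real.cos_two_mul]; congr 1; push_cast; ring
    rw [h2, Int.cast_zero, zero_mul, Real.cos_zero]
    set x := Real.cos (k * θ)
    have hx1 : x ≤ 1 := Real.cos_le_one _
    have hx2 : -1 ≤ x := Real.neg_one_le_cos _
    have h3 : 0 ≤ (φ θ + κ) * ((1 + x) ^ 2 / 2) :=
      mul_nonneg (by linarith [h θ]) (by positivity)
    have h4 : κ * ((1 + x) ^ 2 / 2) ≤ κ * 2 := mul_le_mul_of_nonneg_left (by nlinarith) hκ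
    linarith
  rw [intervalIntegral.integral_sub ((hI 0).add (hI k)) ((((hI 0).sub (hI (2 * k))).const_mul
    _).sub intervalIntegrable_const), intervalIntegral.integral_add (hI 0) (hI k),
    intervalIntegral.integral_sub (((hI 0).sub (hI (2 * k))).const_mul _)
    intervalIntegrable_const, intervalIntegral.integral_const_mul,
    intervalIntegral.integral_sub (hI 0) (hI (2 * k)), intervalIntegral.integral_const,
    smul_eq_mul] at hnn
  have := mul_nonneg (inv_nonneg.2 (by positivity : 0 ≤ 2 * Real.pi)) hnn
  have hππ : (2 * Real.pi)⁻¹ * ((Real.pi - -Real.pi) * (2 * κ)) = 2 * κ := by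
    field_simp; ring
  unfold cosCoeff
  linarith

/-- The symbol of the convolution operator with kernel `w`. -/
noncomputable def symbol (w : ℤ → ℝ) (θ : ℝ) : ℝ := ∑' j : ℤ, w j * Real.cos (j * θ)

theorem continuous_symbol {w : ℤ → ℝ} (hw : Summable w) : Continuous (symbol w) := by
  refine continuous_tsum (fun j => by fun_prop) hw.abs fun j θ => ?_
  rw [norm_mul, Real.norm_eq_abs, Real.norm_eq_abs]
  exact mul_le_of_le_one_right (abs_nonneg _) (Real.abs_cos_le_one _)

theorem abs_symbol_le {w : ℤ → ℝ} (hw : Summable w) (θ : ℝ) : |symbol w θ| ≤ ∑' j, |w j| := by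
  refine abs_tsum_le_tsum hw.abs fun j => ?_
  rw [abs_mul]
  exact mul_le_of_le_one_right (abs_nonneg _) (Real.abs_cos_le_one _)

theorem hasSum_mul_cos_sub {w : ℤ → ℝ} (hw : Summable w) (heven : ∀ k, w (-k) = w k) (k : ℤ)
    (θ : ℝ) : HasSum (fun j : ℤ => w j * Real.cos ((k - j : ℤ) * θ))
      (symbol w θ * Real.cos (k * θ)) := by
  have hc : Summable fun j : ℤ => w j * Real.cos (j * θ) :=
    summable_mul_of_bdd hw fun j => Real.abs_cos_le_one _
  have hs : Summable fun j : ℤ => w j * Real.sin (j * θ) :=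
    summable_mul_of_bdd hw fun j => Real.abs_sin_le_one _
  have hs0 : ∑' j : ℤ, w j * Real.sin (j * θ) = 0 := by
    have h1 : ∑' j : ℤ, w j * Real.sin (j * θ) = -∑' j : ℤ, w j * Real.sin (j * θ) := by
      conv_lhs => rw [← (Equiv.neg ℤ).tsum_eq]
      rw [← tsum_neg]
      refine tsum_congr fun j => ?_
      rw [Equiv.neg_apply, heven]
      push_cast
      rw [neg_mul, Real.sin_neg, mul_neg]
    linarith
  have h := (hc.hasSum.mul_right (Real.cos (k * θ))).add (hs.hasSum.mul_right (Real.sin (k * θ)))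
  rw [hs0, zero_mul, add_zero] at h
  have hf : (fun j : ℤ => w j * Real.cos ((k - j : ℤ) * θ)) = fun j : ℤ =>
      w j * Real.cos (j * θ) * Real.cos (k * θ) + w j * Real.sin (j * θ) * Real.sin (k * θ) := by
    funext j
    push_cast
    rw [sub_mul, Real.cos_sub]; ring
  rw [hf]
  exact h

theorem cosCoeff_symbol_mul {w : ℤ → ℝ} (hw : Summable w) (heven : ∀ k, w (-k) = w k)
    {φ : ℝ → ℝ} (hφ : Continuous φ) (k : ℤ) :
    cosCoeff (fun θ => symbol w θ * φ θ) k = conv w (cosCoeff φ) k := by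
  have h := intervalIntegral.hasSum_integral_of_dominated_convergence (a := -Real.pi)
    (b := Real.pi) (μ := MeasureTheory.volume)
    (F := fun (j : ℤ) θ => φ θ * (w j * Real.cos ((k - j : ℤ) * θ)))
    (f := fun θ => φ θ * (symbol w θ * Real.cos (k * θ))) (fun j θ => |w j| * |φ θ|)
    (fun j => (Continuous.aestronglyMeasurable (by fun_prop)))
    (fun j => Filter.Eventually.of_forall fun θ _ => by
      rw [norm_mul, norm_mul, Real.norm_eq_abs, Real.norm_eq_abs, Real.norm_eq_abs, mul_comm]
      exact mul_le_mul_of_nonneg_right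
        (mul_le_of_le_one_right (abs_nonneg _) (Real.abs_cos_le_one _)) (abs_nonneg _))
    (Filter.Eventually.of_forall fun θ _ => hw.abs.mul_right _)
    (by simp_rw [tsum_mul_right]; exact (continuous_const.mul hφ.abs).intervalIntegrable _ _)
    (Filter.Eventually.of_forall fun θ _ => (hasSum_mul_cos_sub hw heven k θ).mul_left (φ θ))
  have h' := h.mul_left (2 * Real.pi)⁻¹
  unfold conv
  have hl : cosCoeff (fun θ => symbol w θ * φ θ) k =
      (2 * Real.pi)⁻¹ * ∫ θ in (-Real.pi)..Real.pi, φ θ * (symbol w θ * Real.cos (k * θ)) := by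
    unfold cosCoeff
    congr 2
    funext θ; ring
  rw [hl, ← h'.tsum_eq]
  refine tsum_congr fun j => ?_
  unfold cosCoeff
  rw [← mul_assoc, mul_comm (w j), mul_assoc, ← intervalIntegral.integral_const_mul (w j)]
  congr 2
  funext θ; ring

theorem exists_certificate_of_isolating {K : Set ℤ} {s ν A M d t : ℝ} {w p q v : ℤ → ℝ}
    (hs : 0 < s) (hν : 0 < ν) (hK : Separated K (ν * s)) (hw : Summable w)
    (hA : 0 ≤ A) (hp : ∀ k, |p k| ≤ A * decay s k) (hq : ∀ k, |q k| ≤ A * decay s k)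
    (hp1 : ∀ k, |p k| ≤ 1) (hpq : conv w p = q) (hq0 : 0 < q 0)
    (hd : 0 ≤ d) (hgap : ∀ k, k ≠ 0 → |q k| ≤ q 0 - d)
    (hM1 : 1 ≤ M) (hM : A / q 0 ≤ M)
    (ht : tailConst / ν ^ 2 = t) (hsmall : 4 * (M * t) ≤ 1)
    (hv : ∀ m ∈ K, |v m| = 1) (hv0 : ∀ m, m ∉ K → v m = 0) :
    ∃ c : ℤ → ℝ, (∀ k, |c k| ≤ (1 + 4 * (M * t) + 2 * (A * t)) / q 0) ∧
      (∀ k ∈ K, conv w c k = v k) ∧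
      ∀ k, k ∉ K → |conv w c k| ≤ 1 - (d / q 0 - 6 * (M * t)) := by
  have ht0 : 0 ≤ t := ht ▸ div_nonneg tailConst_nonneg (sq_nonneg ν)
  have hM0 : 0 ≤ M := by linarith
  have hMt : 0 ≤ M * t := mul_nonneg hM0 ht0
  have hAt : 0 ≤ A * t := mul_nonneg hA ht0
  set G : ℤ → ℝ := fun k => (q 0)⁻¹ * q k
  set H₁ : ℤ → ℝ := fun k => if k = 0 then 1 else 0
  have hG : ∀ k, |G k| ≤ M * decay s k := fun k => by
    rw [abs_mul, abs_of_pos (inv_pos.2 hq0)]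
    calc (q 0)⁻¹ * |q k| ≤ (q 0)⁻¹ * (A * decay s k) := by have := hq k; gcongr
      _ = A / q 0 * decay s k := by ring
      _ ≤ M * decay s k := mul_le_mul_of_nonneg_right hM (decay_nonneg _ _)
  have hz : ∀ k : ℤ, |(fun _ => 0 : ℤ → ℝ) k| ≤ M * decay s k := fun k => by
    rw [abs_zero]; exact mul_nonneg hM0 (decay_nonneg _ _)
  have hH₁ : ∀ k, |H₁ k| ≤ M * decay s k := fun k => by
    by_cases hk : k = 0
    · simp only [H₁, hk, if_true, abs_one, decay_zero, mul_one]; exact hM1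
    · simp only [H₁, hk, if_false]; exact hz k
  have hv1 : ∀ m, |v m| ≤ 1 := fun m => by
    by_cases hm : m ∈ K
    · exact (hv m hm).le
    · rw [hv0 m hm, abs_zero]; exact zero_le_one
  obtain ⟨a, b, ha0, -, ha2, -, hav, hI⟩ := exists_interpolation hs hν hK hM0 hG hz hz hH₁
    (inv_mul_cancel₀ hq0.ne') rfl rfl (if_pos rfl) (by rw [ht]; exact hsmall) hv1 hv0
  rw [ht] at hav
  have ha1 : ∀ m, |a m| ≤ 1 + 4 * (M * t) := fun m => by
    have h1 := hav m
    have h2 := hv1 m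
    have h3 := abs_add_le (a m - v m) (v m)
    rw [sub_add_cancel] at h3
    linarith
  have hcc : conv w (fun k => (q 0)⁻¹ * conv a p k) = conv a G := by
    funext k
    rw [conv_smul_right, conv_conv_comm hw (summable_of_decay hs hp) ha2, hpq, ← conv_smul_right]
  refine ⟨fun k => (q 0)⁻¹ * conv a p k, fun k => ?_, fun k hk => ?_, fun k hk => ?_⟩
  · rw [abs_mul, abs_of_pos (inv_pos.2 hq0), inv_mul_eq_div]
    refine div_le_div_of_nonneg_right ?_ hq0.le
    by_cases hk : ∃ m₀ ∈ K, |(k : ℝ) - m₀| < ν * s / 2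
    · obtain ⟨m₀, hm₀, hk⟩ := hk
      have h := abs_conv_sub_near_le hs hν hK hA hp ha2 ha0 hm₀ hk
      rw [ht] at h
      have h2 : |a m₀ * p (k - m₀)| ≤ 1 + 4 * (M * t) := by
        rw [abs_mul]
        exact (mul_le_of_le_one_right (abs_nonneg _) (hp1 _)).trans (ha1 _)
      have h3 := abs_add_le (conv a p k - a m₀ * p (k - m₀)) (a m₀ * p (k - m₀))
      rw [sub_add_cancel] at h3
      linarith
    · push Not at hk
      have h := abs_conv_le_of_away hs hν hK hA hp ha2 ha0 hk
      rw [ht] at h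
      linarith
  · rw [hcc]
    have h := (hI k hk).1
    have h0 : conv b (fun _ => 0) k = 0 := by simp [conv]
    rw [h0, add_zero] at h
    exact h
  · rw [hcc]
    have hgap1 := (abs_nonneg _).trans (hgap 1 one_ne_zero)
    have hd1 : d / q 0 ≤ 1 := (div_le_one hq0).2 (by linarith)
    by_cases hkm : ∃ m₀ ∈ K, |(k : ℝ) - m₀| < ν * s / 2
    · obtain ⟨m₀, hm₀, hkm⟩ := hkm
      have h := abs_conv_sub_near_le hs hν hK hM0 hG ha2 ha0 hm₀ hkm
      rw [ht] at h
      have hne : k - m₀ ≠ 0 := fun h0 => hk (by rwa [sub_eq_zero.1 h0])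
      have hGk : |G (k - m₀)| ≤ 1 - d / q 0 := by
        rw [abs_mul, abs_of_pos (inv_pos.2 hq0), inv_mul_eq_div, one_sub_div hq0.ne']
        exact div_le_div_of_nonneg_right (hgap _ hne) hq0.le
      have hG1 : |G (k - m₀)| ≤ 1 := hGk.trans <| by
        have := div_nonneg hd hq0.le
        linarith
      have h2 : |a m₀ * G (k - m₀)| ≤ 1 - d / q 0 + 4 * (M * t) := by
        rw [abs_mul]
        have h4 := mul_le_mul_of_nonneg_right (ha1 m₀) (abs_nonneg (G (k - m₀)))
        have h5 := mul_le_mul_of_nonneg_left hG1 hMt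
        linarith
      have h3 := abs_add_le (conv a G k - a m₀ * G (k - m₀)) (a m₀ * G (k - m₀))
      rw [sub_add_cancel] at h3
      linarith
    · push Not at hkm
      have h := abs_conv_le_of_away hs hν hK hM0 hG ha2 ha0 hkm
      rw [ht] at h
      linarith

theorem continuous_eval_symbol {w : ℤ → ℝ} (hw : Summable w) (P : Polynomial ℝ) :
    Continuous fun θ => P.eval (symbol w θ) :=
  P.continuous.comp (continuous_symbol hw)

theorem exists_forall_abs_cosCoeff_le (P : Polynomial ℝ) (C S : ℝ) (hC : 0 < C) :
    ∃ A, 0 ≤ A ∧ ∀ s, 0 < s → s ≤ S → ∀ w : ℤ → ℝ, (∀ k, w (-k) = w k) →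
      (∀ k, |w k| ≤ C * decay s k) →
      ∀ k, |cosCoeff (fun θ => P.eval (symbol w θ)) k| ≤ A * decay s k := by
  induction P using Polynomial.induction_on with
  | C a =>
    refine ⟨|a|, abs_nonneg _, fun s _ _ w _ _ k => ?_⟩
    have h : cosCoeff (fun θ => (Polynomial.C a).eval (symbol w θ)) k =
        a * cosCoeff (fun _ => 1) k := by
      rw [← cosCoeff_const_mul]; simp
    rw [h, cosCoeff_one, abs_mul]
    refine mul_le_mul_of_nonneg_left ?_ (abs_nonneg _)
    split_ifs with hk
    · rw [hk, decay_zero, abs_one]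
    · rw [abs_zero]; exact decay_nonneg _ _
  | add p q hp hq =>
    obtain ⟨A, hA0, hA⟩ := hp
    obtain ⟨B, hB0, hB⟩ := hq
    refine ⟨A + B, add_nonneg hA0 hB0, fun s hs hsS w heven hw k => ?_⟩
    have hc := continuous_eval_symbol (summable_of_decay hs hw)
    simp only [Polynomial.eval_add]
    rw [cosCoeff_add (hc p) (hc q), add_mul]
    exact (abs_add_le _ _).trans (add_le_add (hA s hs hsS w heven hw k) (hB s hs hsS w heven hw k))
  | monomial n a h =>
    obtain ⟨A, hA0, hA⟩ := h
    refine ⟨C * A * (4 * (1 + Real.pi * max S 0)), by positivity,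
      fun s hs hsS w heven hw k => ?_⟩
    have hc := continuous_eval_symbol (summable_of_decay hs hw)
    have he : (fun θ => (Polynomial.C a * Polynomial.X ^ (n + 1)).eval (symbol w θ)) =
        fun θ => symbol w θ * (Polynomial.C a * Polynomial.X ^ n).eval (symbol w θ) := by
      funext θ; simp; ring
    rw [he, cosCoeff_symbol_mul (summable_of_decay hs hw) heven (hc _)]
    refine (abs_conv_le_of_decay hs hw (hA s hs hsS w heven hw) k).trans ?_
    have := decay_nonneg s k
    have hπ := Real.pi_pos
    have := hsS.trans (le_max_left S 0)
    gcongr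

theorem Bump.exists_isolating {g g₁ g₂ : ℝ → ℝ} {ε β' C : ℝ} (hb : Bump g g₁ g₂ ε β' C) {β S : ℝ}
    (hββ' : β < β') (hS : 0 < S) :
    ∃ A, 0 ≤ A ∧ ∀ s, 0 < s → s ≤ S → ∃ p q : ℤ → ℝ,
      (∀ k, |p k| ≤ A * decay s k) ∧ (∀ k, |q k| ≤ A * decay s k) ∧ (∀ k, |p k| ≤ 1) ∧
      conv (samples g s) p = q ∧ g 0 / 2 ≤ q 0 ∧
      ∀ k, k ≠ 0 → |q k| ≤ q 0 - β / (8 * max s ε⁻¹ ^ 2) := by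
  have hε := hb.eps_pos
  have hC := hb.const_pos
  have hβ' := hb.beta_pos
  have hπ := Real.pi_pos
  set Γ := max S ε⁻¹ with hΓ
  have hΓ0 : 0 < Γ := lt_max_of_lt_left hS
  set κ := min (1 / 2) ((β' - β) / (β' + 16 * Γ ^ 2)) with hκ_def
  have hκ : 0 < κ := lt_min (by norm_num) (div_pos (sub_pos.2 hββ') (by positivity))
  have hκ2 : κ ≤ 1 / 2 := min_le_left _ _
  have hκ3 : κ * (β' + 16 * Γ ^ 2) ≤ β' - β :=
    (le_div_iff₀ (by positivity)).1 (min_le_right _ _)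
  obtain ⟨P, hP⟩ := exists_cutoff_polynomial (B := C * (1 + Real.pi * S)) (by positivity) hκ
    (by linarith)
  obtain ⟨A₁, hA₁0, hA₁⟩ := exists_forall_abs_cosCoeff_le P C S hC
  obtain ⟨A₂, hA₂0, hA₂⟩ := exists_forall_abs_cosCoeff_le (Polynomial.X * P) C S hC
  refine ⟨max A₁ A₂, le_max_of_le_left hA₁0, fun s hs hsS => ?_⟩
  set w := samples g s with hw_def
  have hw : ∀ k, |w k| ≤ C * decay s k := abs_samples_le hb.abs_le s
  have heven : ∀ k, w (-k) = w k := samples_neg hb.even s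
  have hsum : Summable w := summable_of_decay hs hw
  have hwB : ∀ θ, |symbol w θ| ≤ C * (1 + Real.pi * S) := fun θ =>
    (abs_symbol_le hsum θ).trans <| (tsum_abs_le_of_decay hs hC.le hw).trans <| by gcongr
  have hcP := continuous_eval_symbol hsum P
  have hcs := continuous_symbol hsum
  set p := cosCoeff fun θ => P.eval (symbol w θ)
  set q := cosCoeff fun θ => symbol w θ * P.eval (symbol w θ) with hq_def
  have hpq : conv w p = q := funext fun k => (cosCoeff_symbol_mul hsum heven hcP k).symm
  have hsw : ∀ k, cosCoeff (symbol w) k = w k := fun k => by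
    have h := cosCoeff_symbol_mul hsum heven (continuous_const (y := (1 : ℝ))) k
    simp only [mul_one] at h
    have h1 : cosCoeff (fun _ => 1) = fun k : ℤ => if k = 0 then 1 else 0 := funext cosCoeff_one
    rw [h, h1]
    unfold conv
    rw [tsum_eq_single k fun j hj => by simp [sub_ne_zero.2 hj.symm]]
    simp
  have hcF : Continuous fun θ => symbol w θ * P.eval (symbol w θ) := hcs.mul hcP
  have hcκ : Continuous fun θ => -(1 - κ) * symbol w θ := continuous_const.mul hcs
  have hcFκ : Continuous fun θ =>
      symbol w θ * P.eval (symbol w θ) + -(1 - κ) * symbol w θ := hcF.add hcκ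
  have hφ0 : ∀ θ, 0 ≤ symbol w θ * P.eval (symbol w θ) + -(1 - κ) * symbol w θ := fun θ => by
    have := (hP _ (hwB θ)).2.1
    linarith
  have hφ : ∀ k, cosCoeff (fun θ => symbol w θ * P.eval (symbol w θ) + -(1 - κ) * symbol w θ) k =
      q k + -(1 - κ) * w k := fun k => by
    rw [cosCoeff_add hcF hcκ, cosCoeff_const_mul, hsw]
  have hdiff : ∀ k, (1 - κ) * (w 0 - w k) ≤ q 0 - q k := fun k => by
    have h := cosCoeff_le_zero hcFκ hφ0 k
    rw [hφ, hφ] at h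
    linarith
  have hw0 : w 0 = g 0 := by simp [hw_def, samples]
  have hg0 : 0 < g 0 := hb.pos 0 (by simpa using hε.le)
  have hq0 : (1 - κ) * w 0 ≤ q 0 := by
    have h := cosCoeff_zero_nonneg hφ0
    rw [hφ] at h
    linarith
  set γ := max s ε⁻¹ with hγ
  have hγ0 : 0 < γ := lt_max_of_lt_left hs
  have hγΓ : γ ≤ Γ := max_le_max_right _ hsS
  have hdrop : ∀ k : ℤ, k ≠ 0 → β' / (2 * γ ^ 2) ≤ w 0 - w k := fun k hk => by
    have h := hb.le_drop_zero ((k : ℝ) / s)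
    rw [hw0]
    refine le_trans ?_ h
    have hk1 : (1 : ℝ) ≤ |(k : ℝ)| := by exact_mod_cast Int.one_le_abs hk
    have h1 : γ⁻¹ ≤ min |(k : ℝ) / s| ε := by
      refine le_min ?_ (inv_le_of_inv_le₀ hε (le_max_right _ _))
      rw [abs_div, abs_of_pos hs, ← one_div]
      exact div_le_div₀ (abs_nonneg _) hk1 hs (le_max_left _ _)
    calc β' / (2 * γ ^ 2) = β' / 2 * γ⁻¹ ^ 2 := by field_simp
      _ ≤ _ := by gcongr
  have hκβ : β / (8 * γ ^ 2) ≤ (1 - κ) * (β' / (2 * γ ^ 2)) / 4 - 2 * κ := by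
    have h1 : κ * (16 * γ ^ 2) ≤ κ * (16 * Γ ^ 2) := by gcongr
    rw [div_le_iff₀ (by positivity)]
    have h2 : ((1 - κ) * (β' / (2 * γ ^ 2)) / 4 - 2 * κ) * (8 * γ ^ 2) =
        (1 - κ) * β' - κ * (16 * γ ^ 2) := by field_simp; ring
    rw [h2]
    linarith
  have hlow : ∀ k : ℤ, k ≠ 0 → (1 - κ) * (β' / (2 * γ ^ 2)) ≤ q 0 - q k := fun k hk =>
    (mul_le_mul_of_nonneg_left (hdrop k hk) (by linarith)).trans (hdiff k)
  refine ⟨p, q, fun k => (hA₁ s hs hsS w heven hw k).trans ?_, fun k => ?_,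
    abs_cosCoeff_le fun θ => (hP _ (hwB θ)).1, hpq, ?_, fun k hk => ?_⟩
  · exact mul_le_mul_of_nonneg_right (le_max_left _ _) (decay_nonneg _ _)
  · have h := hA₂ s hs hsS w heven hw k
    simp only [Polynomial.eval_mul, Polynomial.eval_X] at h
    exact h.trans (mul_le_mul_of_nonneg_right (le_max_right _ _) (decay_nonneg _ _))
  · rw [hw0] at hq0
    have := mul_le_mul_of_nonneg_right hκ2 hg0.le
    linarith
  · have h1 := hlow k hk
    have h2 := hlow (2 * k) (mul_ne_zero two_ne_zero hk)
    have h3 := le_cosCoeff_add hcF hκ.le (fun θ => (hP _ (hwB θ)).2.2) k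
    rw [← hq_def] at h3
    have h4 : 0 ≤ (1 - κ) * (β' / (2 * γ ^ 2)) := mul_nonneg (by linarith) (by positivity)
    rw [_root_.abs_le]
    constructor <;> linarith

theorem Bump.exists_certificate_of_small {g g₁ g₂ : ℝ → ℝ} {ε β' C : ℝ}
    (hb : Bump g g₁ g₂ ε β' C) {β S : ℝ} (hβ : 0 < β) (hββ' : β < β') (hS : 0 < S) :
    ∃ ν₀, 0 < ν₀ ∧ ∀ s, 0 < s → s ≤ S → ∀ ν ≥ ν₀, ∀ K : Set ℤ, Separated K (ν * s) →
      ∀ v : ℤ → ℝ, (∀ m ∈ K, |v m| = 1) → (∀ m, m ∉ K → v m = 0) →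
      ∃ (c : ℤ → ℝ) (B τ : ℝ), 0 < τ ∧ B ≤ 8 * max s ε⁻¹ ^ 2 / β * τ ∧ (∀ k, |c k| ≤ B) ∧
        (∀ k ∈ K, conv (samples g s) c k = v k) ∧
        ∀ k, k ∉ K → |conv (samples g s) c k| ≤ 1 - τ := by
  obtain ⟨ρ, hρ, hρβ'⟩ := exists_between hββ'
  have hρ0 := hβ.trans hρ
  obtain ⟨A, hA, hiso⟩ := hb.exists_isolating hρβ' hS
  have hg0 : 0 < g 0 := hb.pos 0 (by simpa using hb.eps_pos.le)
  set Γ := max S ε⁻¹ with hΓ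
  set M := max 1 (A / (g 0 / 2)) with hM
  have hM1 : 1 ≤ M := le_max_left _ _
  set D := 4 * M + 2 * A + 48 * Γ ^ 2 * M * A / β with hD_def
  have hD : 0 < D := by positivity
  obtain ⟨ν₀, -, hν₀, hν⟩ := exists_forall_div_sq_le tailConst
    (q := min (1 / (4 * M)) ((ρ / β - 1) / D))
    (lt_min (by positivity) (div_pos (sub_pos.2 ((one_lt_div hβ).2 hρ)) hD)) 0
  refine ⟨ν₀, hν₀, fun s hs hsS ν hνν₀ K hK v hv hv0 => ?_⟩
  obtain ⟨p, q, hp, hq, hp1, hpq, hq0, hgap⟩ := hiso s hs hsS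
  have hνp : 0 < ν := hν₀.trans_le hνν₀
  set t := tailConst / ν ^ 2 with ht
  have ht0 : 0 ≤ t := div_nonneg tailConst_nonneg (sq_nonneg ν)
  have ht1 : 4 * (M * t) ≤ 1 := by
    have h := (le_div_iff₀ (by positivity)).1 ((hν ν hνν₀).trans (min_le_left _ _))
    rw [← ht] at h
    linarith
  have ht2 : t * D ≤ ρ / β - 1 :=
    (le_div_iff₀ hD).1 ((hν ν hνν₀).trans (min_le_right _ _))
  have hq0p : 0 < q 0 := by linarith
  have hqA : q 0 ≤ A := by
    have h := hq 0
    rw [decay_zero, mul_one] at h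
    exact (le_abs_self _).trans h
  set γ := max s ε⁻¹ with hγ
  have hγ0 : 0 < γ := lt_max_of_lt_left hs
  have hγΓ : γ ≤ Γ := max_le_max_right _ hsS
  obtain ⟨c, hc, hcK, hcfar⟩ := exists_certificate_of_isolating hs hνp hK (hb.summable_samples hs)
    hA hp hq hp1 hpq hq0p (by positivity) hgap hM1
    ((div_le_div_of_nonneg_left hA (by positivity) hq0).trans (le_max_right _ _)) ht.symm ht1 hv hv0
  have hBτ : (1 + 4 * (M * t) + 2 * (A * t)) / q 0 ≤
      8 * γ ^ 2 / β * (ρ / (8 * γ ^ 2) / q 0 - 6 * (M * t)) := by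
    rw [div_le_iff₀ hq0p]
    have h1 : 8 * γ ^ 2 / β * (ρ / (8 * γ ^ 2) / q 0 - 6 * (M * t)) * q 0 =
        ρ / β - 48 * γ ^ 2 * M * q 0 / β * t := by
      field_simp
      ring
    have h2 : 48 * γ ^ 2 * M * q 0 / β * t ≤ 48 * Γ ^ 2 * M * A / β * t := by gcongr
    rw [h1]
    rw [hD_def] at ht2
    linarith
  refine ⟨c, _, _, ?_, hBτ, hc, hcK, hcfar⟩
  have h := lt_of_lt_of_le (show 0 < (1 + 4 * (M * t) + 2 * (A * t)) / q 0 by positivity) hBτ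
  exact (pos_iff_pos_of_mul_pos h).1 (by positivity)

theorem Bump.exists_certificate {g g₁ g₂ : ℝ → ℝ} {ε β' C : ℝ}
    (hb : Bump g g₁ g₂ ε β' C) {β : ℝ} (hβ : 0 < β) (hββ' : β < β') :
    ∃ ν₀, ∀ s, 0 < s → ∀ ν ≥ ν₀, ∀ K : Set ℤ, Separated K (ν * s) →
      ∀ v : ℤ → ℝ, (∀ m ∈ K, |v m| = 1) → (∀ m, m ∉ K → v m = 0) →
      ∃ (c : ℤ → ℝ) (B τ : ℝ), 0 < τ ∧ B ≤ 8 * max s ε⁻¹ ^ 2 / β * τ ∧ (∀ k, |c k| ≤ B) ∧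
        (∀ k ∈ K, conv (samples g s) c k = v k) ∧ (∀ k, |conv (samples g s) c k| ≤ 1) ∧
        ∀ k : ℤ, (∀ m ∈ K, s * ε < |(k : ℝ) - m|) → |conv (samples g s) c k| ≤ 1 - τ := by
  have hε := hb.eps_pos
  obtain ⟨B, τ, ν₁, hτ, -, hlarge⟩ := hb.exists_certificate_of_large
  set S := max 1 (max (8 / ε) (β * B / (8 * τ))) with hS_def
  have hS : 1 ≤ S := le_max_left _ _
  obtain ⟨ν₂, -, hsmall⟩ := hb.exists_certificate_of_small hβ hββ' (zero_lt_one.trans_le hS)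
  refine ⟨max ν₁ ν₂, fun s hs ν hν K hK v hv hv0 => ?_⟩
  rcases le_total s S with hsS | hsS
  · obtain ⟨c, B, τ, hτ, hBτ, hc, hcK, hfar⟩ :=
      hsmall s hs hsS ν ((le_max_right _ _).trans hν) K hK v hv hv0
    refine ⟨c, B, τ, hτ, hBτ, hc, hcK, fun k => ?_, fun k hk => hfar k fun hkK => ?_⟩
    · by_cases hk : k ∈ K
      · rw [hcK k hk, hv k hk]
      · exact (hfar k hk).trans (by linarith)
    · have h := hk k hkK
      rw [sub_self, abs_zero] at h
      exact absurd h (not_lt.2 (by positivity))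
  · obtain ⟨c, hc, hcK, hc1, hfar⟩ := hlarge s (hS.trans hsS)
      (((le_max_left _ _).trans (le_max_right _ _)).trans hsS) ν ((le_max_left _ _).trans hν) K hK
      v hv hv0
    refine ⟨c, B, τ, hτ, ?_, hc, hcK, hc1, hfar⟩
    have h1 : β * B / (8 * τ) ≤ max s ε⁻¹ :=
      (((le_max_right _ _).trans (le_max_right _ _)).trans hsS).trans (le_max_left _ _)
    have h2 : 1 ≤ max s ε⁻¹ := (hS.trans hsS).trans (le_max_left _ _)
    have h3 : β * B / (8 * τ) ≤ max s ε⁻¹ ^ 2 := h1.trans (le_self_pow₀ h2 two_ne_zero)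
    rw [div_le_iff₀ (by positivity)] at h3
    rw [div_mul_eq_mul_div, le_div_iff₀ hβ]
    linarith

/-- If the noise is absolutely summable, feasibility bounds the distance of the data. -/
theorem tsum_abs_conv_sub_conv_le {u z w η y : ℤ → ℝ} {δ : ℝ} (hu : Summable u) (hz : Summable z)
    (hw : Summable w) (hη : Summable fun k => |η k|) (hηδ : ∑' k, |η k| ≤ δ)
    (hy : ∀ k, y k = conv w u k + η k) (hfeas : ∑' k, |y k - conv w z k| ≤ δ) :
    ∑' k, |conv u w k - conv z w k| ≤ 2 * δ := by
  have h1 : Summable fun k => |y k - conv w z k| := by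
    refine (((summable_conv hw hu).add hη.of_abs).sub (summable_conv hw hz)).abs.congr fun k => ?_
    rw [hy]
  calc ∑' k, |conv u w k - conv z w k| ≤ ∑' k, (|y k - conv w z k| + |η k|) := by
        refine Summable.tsum_le_tsum (fun k => ?_)
          ((summable_conv hu hw).sub (summable_conv hz hw)).abs (h1.add hη)
        rw [conv_comm u w, conv_comm z w]
        have h : conv w u k - conv w z k = (y k - conv w z k) - η k := by rw [hy]; ring
        rw [h]
        exact abs_sub _ _
    _ = ∑' k, |y k - conv w z k| + ∑' k, |η k| := h1.tsum_add hη
    _ ≤ 2 * δ := by linarith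

theorem tsum_far_minimizer_le {w c x z η y : ℤ → ℝ} {F : Set ℤ} {B δ τ : ℝ}
    (hw : Summable w) (heven : ∀ k, w (-k) = w k) (hx : Summable x) (hz : Summable z)
    (hc : ∀ k, |c k| ≤ B) (hle : ∀ k, |conv w c k| ≤ 1)
    (hsign : ∀ k, x k * conv w c k = |x k|) (hfar : ∀ k ∈ F, |conv w c k| ≤ 1 - τ) (hτ : 0 ≤ τ)
    (hη : ∑' k, |η k| ≤ δ) (hδ : 0 ≤ δ) (hy : ∀ k, y k = conv w x k + η k)
    (hfeas : ∑' k, |y k - conv w z k| ≤ δ)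
    (hmin : ∀ u, Summable u → ∑' k, |y k - conv w u k| ≤ δ → ∑' k, |z k| ≤ ∑' k, |u k|) :
    τ * ∑' k : F, |z k| ≤ 2 * δ * B := by
  have hB : 0 ≤ B := (abs_nonneg _).trans (hc 0)
  by_cases hs : Summable fun k => |η k|
  · refine tsum_far_le_of_certificate hw heven hx hz hc hle hsign hfar
      (hmin x hx (by simpa [hy] using hη)) ?_
    exact tsum_abs_conv_sub_conv_le hx hz hw hs hη hy hfeas
  · have h0 : ∑' k, |y k - conv w 0 k| ≤ δ := by
      rw [tsum_eq_zero_of_not_summable fun h => hs ?_]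
      · exact hδ
      refine (h.of_abs.sub (summable_conv hw hx)).abs.congr fun k => ?_
      simp [hy, conv]
    have h1 := hmin 0 summable_zero h0
    simp only [Pi.zero_apply, abs_zero, tsum_zero] at h1
    have h2 : ∑' k : F, |z k| ≤ ∑' k, |z k| := hz.abs.tsum_subtype_le _ F fun _ => abs_nonneg _
    have h3 : τ * ∑' k : F, |z k| ≤ 0 := mul_nonpos_of_nonneg_of_nonpos hτ (h2.trans h1)
    exact h3.trans (by positivity)

end SpikeRecovery

open SpikeRecovery

/-- Corollary 2.5 (small far-region false detections): the spikes of the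
minimizer `x̂` located in the far region `ℤ_far` (farther than `Nεσ` from every
true support point) have total amplitude at most `16 γ² δ / β`. -/
theorem small_far_region_false_detections
    (g : ℝ → ℝ) (ε β : ℝ) (hg : IsAdmissibleKernel g ε β) :
    ∃ ν : ℝ, ν > max ε β ∧
      ∀ (N : ℕ), 1 ≤ N → ∀ σ : ℝ, 0 < σ → ∀ δ : ℝ, 0 ≤ δ →
      ∀ x : ℤ → ℝ, Summable x →
      -- minimal separation condition on the support `K` of `x`
      (∀ ki ∈ Function.support x, ∀ kj ∈ Function.support x, ki ≠ kj →
        (N : ℝ) * ν * σ ≤ |(ki : ℝ) - (kj : ℝ)|) →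
      ∀ η : ℤ → ℝ, (∑' k : ℤ, |η k|) ≤ δ →
      ∀ y : ℤ → ℝ,
        (∀ k : ℤ, y k =
          (∑' j : ℤ, g (((k : ℝ) - (j : ℝ)) / (σ * N)) * x j) + η k) →
      ∀ xhat : ℤ → ℝ, Summable xhat →
        -- `x̂` is feasible
        (∑' k : ℤ,
          |y k - ∑' j : ℤ, g (((k : ℝ) - (j : ℝ)) / (σ * N)) * xhat j|) ≤ δ →
        -- `x̂` minimizes the ℓ¹ norm among all summable feasible points
        (∀ xt : ℤ → ℝ, Summable xt →
          (∑' k : ℤ,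
            |y k - ∑' j : ℤ, g (((k : ℝ) - (j : ℝ)) / (σ * N)) * xt j|) ≤ δ →
          (∑' k : ℤ, |xhat k|) ≤ (∑' k : ℤ, |xt k|)) →
      -- sum of `|x̂|` over `K̂_far = ℤ_far ∩ K̂`
      (∑' k : {k : ℤ //
          (∀ km ∈ Function.support x, (N : ℝ) * ε * σ < |(k : ℝ) - (km : ℝ)|) ∧
          xhat k ≠ 0},
        |xhat (k : ℤ)|) ≤
        16 * (max ((N : ℝ) * σ) ε⁻¹) ^ 2 / β * δ := by
  obtain ⟨β', hβ', C, hb⟩ := exists_bump hg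
  obtain ⟨ν₀, hν₀⟩ := hb.exists_certificate hg.beta_pos hβ'
  refine ⟨max ν₀ (max ε β + 1), (lt_add_one _).trans_le (le_max_right _ _), ?_⟩
  intro N hN σ hσ δ hδ x hx hsep η hη y hy xhat hxhat hfeas hmin
  have hN0 : (0 : ℝ) < N := by exact_mod_cast hN
  have hβ := hg.beta_pos
  have hs : 0 < (N : ℝ) * σ := mul_pos hN0 hσ
  have hconv : ∀ (u : ℤ → ℝ) (k : ℤ), ∑' j : ℤ, g (((k : ℝ) - (j : ℝ)) / (σ * N)) * u j =
      conv (samples g (N * σ)) u k := fun u k => by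
    rw [conv_comm, mul_comm (N : ℝ) σ]
    unfold conv samples
    refine tsum_congr fun j => ?_
    push_cast
    exact mul_comm _ _
  simp only [hconv] at hy hfeas hmin
  set v : ℤ → ℝ := fun k => SignType.sign (x k)
  have hv : ∀ m ∈ Function.support x, |v m| = 1 := fun m hm => by
    rcases lt_or_gt_of_ne (Function.mem_support.1 hm) with h | h
    · simp [v, sign_neg h]
    · simp [v, sign_pos h]
  obtain ⟨c, B, τ, hτ, hBτ, hc, hcK, hc1, hfar⟩ := hν₀ (N * σ) hs _ (le_max_left _ _)
    (Function.support x) (fun i hi j hj hij => by have := hsep i hi j hj hij; linarith) v hv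
    fun m hm => by simp [v, Function.notMem_support.1 hm]
  have hsign : ∀ k, x k * conv (samples g (N * σ)) c k = |x k| := fun k => by
    by_cases hk : x k = 0
    · rw [hk, zero_mul, abs_zero]
    · rw [hcK k hk]; exact self_mul_sign _
  have key := tsum_far_minimizer_le
    (F := {k : ℤ | (∀ km ∈ Function.support x, (N : ℝ) * ε * σ < |(k : ℝ) - (km : ℝ)|) ∧
      xhat k ≠ 0}) (hb.summable_samples hs) (samples_neg hb.even _) hx hxhat hc hc1 hsign
    (fun k hk => hfar k fun m hm => by have := hk.1 m hm; linarith) hτ.le hη hδ hy hfeas hmin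
  have hB := mul_le_mul_of_nonneg_left hBτ (show 0 ≤ 2 * δ by positivity)
  refine le_of_mul_le_mul_left ((key.trans hB).trans_eq ?_) hτ
  ring
end

section
/- (Weighted squared-distance bound on the near region, Lemma 3.2.) Let g : ℝ → ℝ be an admissible kernel with constants ε, β, let N ≥ 1, σ > 0, δ ≥ 0, γ := max{Nσ, ε^{-1}}, and let x[k] = Σ_m c_m δ[k − k_m] be a spike train with finite support K = {k_m} ⊂ ℤ whose windows ℤ_m := {k ∈ ℤ : |k − k_m| ≤ Nεσ} are pairwise disjoint and satisfy ℤ_m ∩ K = {k_m}. Suppose x̂ : ℤ → ℝ is summable with support K̂ = {k̂_n}, values ĉ_n = x̂[k̂_n], and satisfies (i) Σ_k |x̂[k] − x[k]| ≤ (16 γ²/β) δ and (ii) Σ_k |x̂[k]| ≤ Σ_k |x[k]|. Suppose further there exists q : ℤ → ℝ with |q[k]| ≤ 1 for all k ∈ ℤ, q[k_m] = sign(c_m) for all m, and |q[k]| ≤ 1 − β (k − k_m)² / (4 g(0) (Nσ)²) for all k ∈ ℤ_m and all m. Then, with ℤ_near := ∪_m ℤ_m and K̂_near := ℤ_near ∩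 K̂, one has Σ_{n : k̂_n ∈ K̂_near} |ĉ_n| · d²(k̂_n, K) ≤ (64 g(0) γ⁴ / β²) δ, where d(k, K) := min_{k_m ∈ K} |k_m − k|. -/
/-- Lemma 3.2 (weighted squared-distance bound on the near region): under the
stability bound and ℓ¹-minimality of `x̂`, and given a dual certificate `q`,
the spikes of `x̂` in the near region satisfy
`Σ |ĉ_n| d²(k̂_n, K) ≤ 64 g(0) γ⁴ δ / β²`. -/
theorem near_region_weighted_distance_bound
    (g : ℝ → ℝ) (ε β : ℝ) (hg : IsAdmissibleKernel g ε β)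
    (N : ℕ) (hN : 1 ≤ N) (σ δ : ℝ) (hσ : 0 < σ) (hδ : 0 ≤ δ)
    (x : ℤ → ℝ) (hxfin : (Function.support x).Finite)
    -- the windows `ℤ_m` are pairwise disjoint
    (hdisj : ∀ k₁ ∈ Function.support x, ∀ k₂ ∈ Function.support x, k₁ ≠ k₂ →
      ∀ k : ℤ, ¬(|(k : ℝ) - (k₁ : ℝ)| ≤ (N : ℝ) * ε * σ ∧
                 |(k : ℝ) - (k₂ : ℝ)| ≤ (N : ℝ) * ε * σ))
    -- `ℤ_m ∩ K = {k_m}`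
    (hwin : ∀ km ∈ Function.support x, ∀ k ∈ Function.support x,
      |(k : ℝ) - (km : ℝ)| ≤ (N : ℝ) * ε * σ → k = km)
    (xhat : ℤ → ℝ) (hxhat : Summable xhat)
    -- (i) the stability bound
    (h1 : (∑' k : ℤ, |xhat k - x k|) ≤
      16 * (max ((N : ℝ) * σ) ε⁻¹) ^ 2 / β * δ)
    -- (ii) `x̂` has no larger ℓ¹ norm than `x`
    (h2 : (∑' k : ℤ, |xhat k|) ≤ ∑' k : ℤ, |x k|)
    -- the dual certificate `q`
    (q : ℤ → ℝ)
    (hq1 : ∀ k : ℤ, |q k| ≤ 1)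
    (hq2 : ∀ km ∈ Function.support x, q km = Real.sign (x km))
    (hq3 : ∀ km ∈ Function.support x, ∀ k : ℤ,
      |(k : ℝ) - (km : ℝ)| ≤ (N : ℝ) * ε * σ →
      |q k| ≤ 1 - β * ((k : ℝ) - (km : ℝ)) ^ 2 /
        (4 * g 0 * ((N : ℝ) * σ) ^ 2)) :
    -- conclusion: weighted squared-distance bound over `K̂_near = ℤ_near ∩ K̂`
    (∑' k : ℤ,
      ({k : ℤ | ∃ km ∈ Function.support x,
          |(k : ℝ) - (km : ℝ)| ≤ (N : ℝ) * ε * σ}).indicator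
        (fun k => |xhat k| *
          (sInf ((fun km : ℤ => |(km : ℝ) - (k : ℝ)|) '' Function.support x)) ^ 2)
        k) ≤
      64 * g 0 * (max ((N : ℝ) * σ) ε⁻¹) ^ 4 / β ^ 2 * δ := by
  have hNσ : 0 < (N : ℝ) * σ := mul_pos (by exact_mod_cast hN) hσ
  have hβ := hg.beta_pos
  have hg0 : 0 < g 0 := hg.pos_near 0 (by simpa using hg.eps_pos.le)
  set γ := max ((N : ℝ) * σ) ε⁻¹ with hγ
  have hNγ : (N : ℝ) * σ ≤ γ := le_max_left _ _
  set M := 4 * g 0 * ((N : ℝ) * σ) ^ 2 / β with hM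
  have hM0 : 0 < M := by positivity
  have hx : Summable x := summable_of_hasFiniteSupport hxfin
  have hdiff : Summable fun k => |xhat k - x k| := (hxhat.sub hx).abs
  have hnn : ∀ k : ℤ, 0 ≤ ({k : ℤ | ∃ km ∈ Function.support x,
      |(k : ℝ) - (km : ℝ)| ≤ (N : ℝ) * ε * σ}).indicator
      (fun k => |xhat k| *
        (sInf ((fun km : ℤ => |(km : ℝ) - (k : ℝ)|) '' Function.support x)) ^ 2) k :=
    fun k => Set.indicator_nonneg (fun _ _ => by positivity) k
  have hcert : ∀ k : ℤ, (1 - |q k|) * |xhat k| ≤ |xhat k| - |x k| + |xhat k - x k| := by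
    intro k
    have hqx : q k * x k = |x k| := by
      rcases lt_trichotomy (x k) 0 with hk | hk | hk
      · rw [hq2 k hk.ne, Real.sign_of_neg hk, abs_of_neg hk, neg_one_mul]
      · simp [hk]
      · rw [hq2 k hk.ne', Real.sign_of_pos hk, abs_of_pos hk, one_mul]
    have hup : q k * xhat k ≤ |q k| * |xhat k| := abs_mul (q k) (xhat k) ▸ le_abs_self _
    have hlow : -|xhat k - x k| ≤ q k * (xhat k - x k) := by
      refine (neg_le_neg ?_).trans (neg_abs_le _)
      rw [abs_mul]
      exact mul_le_of_le_one_left (abs_nonneg _) (hq1 k)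
    linarith
  have hpt : ∀ k : ℤ, ({k : ℤ | ∃ km ∈ Function.support x,
      |(k : ℝ) - (km : ℝ)| ≤ (N : ℝ) * ε * σ}).indicator
      (fun k => |xhat k| *
        (sInf ((fun km : ℤ => |(km : ℝ) - (k : ℝ)|) '' Function.support x)) ^ 2) k ≤
      M * (|xhat k| - |x k| + |xhat k - x k|) := by
    intro k
    refine le_trans ?_ (mul_le_mul_of_nonneg_left (hcert k) hM0.le)
    refine Set.indicator_apply_le' ?_ fun _ =>
      mul_nonneg hM0.le (mul_nonneg (sub_nonneg.2 (hq1 k)) (abs_nonneg _))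
    rintro ⟨km, hkm, hk⟩
    have hinf : sInf ((fun km : ℤ => |(km : ℝ) - (k : ℝ)|) '' Function.support x) ≤
        |(km : ℝ) - (k : ℝ)| :=
      csInf_le ⟨0, by rintro _ ⟨_, _, rfl⟩; exact abs_nonneg _⟩ ⟨km, hkm, rfl⟩
    have hinf0 : 0 ≤ sInf ((fun km : ℤ => |(km : ℝ) - (k : ℝ)|) '' Function.support x) :=
      Real.sInf_nonneg (by rintro _ ⟨_, _, rfl⟩; exact abs_nonneg _)
    have hsq : sInf ((fun km : ℤ => |(km : ℝ) - (k : ℝ)|) '' Function.support x) ^ 2 ≤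
        ((k : ℝ) - km) ^ 2 := by
      rw [← sq_abs ((k : ℝ) - km), abs_sub_comm (k : ℝ)]
      exact pow_le_pow_left₀ hinf0 hinf 2
    have hq : ((k : ℝ) - km) ^ 2 ≤ M * (1 - |q k|) := by
      have h := mul_le_mul_of_nonneg_left (le_sub_comm.1 (hq3 km hkm k hk)) hM0.le
      refine le_of_eq_of_le ?_ h
      rw [hM]
      field_simp
    calc |xhat k| * sInf ((fun km : ℤ => |(km : ℝ) - (k : ℝ)|) '' Function.support x) ^ 2
        ≤ |xhat k| * (M * (1 - |q k|)) := by gcongr; exact hsq.trans hq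
      _ = M * ((1 - |q k|) * |xhat k|) := by ring
  have hsum := ((hxhat.abs.sub hx.abs).add hdiff).mul_left M
  refine ((hsum.of_nonneg_of_le hnn hpt).tsum_le_tsum hpt hsum).trans ?_
  rw [tsum_mul_left, (hxhat.abs.sub hx.abs).tsum_add hdiff, hxhat.abs.tsum_sub hx.abs]
  calc M * ((∑' k, |xhat k|) - (∑' k, |x k|) + ∑' k, |xhat k - x k|)
      ≤ M * (16 * γ ^ 2 / β * δ) := by gcongr; linarith
    _ ≤ 4 * g 0 * γ ^ 2 / β * (16 * γ ^ 2 / β * δ) := by rw [hM]; gcongr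
    _ = 64 * g 0 * γ ^ 4 / β ^ 2 * δ := by field_simp; ring
end
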